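/- arXiv:1311.7475 — 2 statements merged into one kernel-verified Lean document; each statement's English description precedes it below -/
import Mathlib

section
/- For any point p̃ ∈ M̃ with t(p̃) ≤ 0, the cut locus C_p̃ contains no point with negative t-coordinate; in particular, if t(p̃) = 0 then C_p̃ ⊂ {(t, θ) : t = 0}. Consequently, on the cylinder M, the cut locus C_p of a point p with t(p) = 0 and θ(p) = 0 satisfies C_p ⊂ θ⁻¹(π) ∪ t⁻¹(0). -/
open Real Set

noncomputable section

/-- Length of a C¹ curve `c` on `[a,b]` in the warped product metric
`ds² = dt² + m(t)² dθ²` on `M̃ = ℝ²` (coordinates `(t,θ)`). -/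
def wLength (m : ℝ → ℝ) (c : ℝ → ℝ × ℝ) (a b : ℝ) : ℝ :=
  ∫ s in a..b,
    Real.sqrt ((deriv (fun u => (c u).1) s) ^ 2 +
      (m (c s).1) ^ 2 * (deriv (fun u => (c u).2) s) ^ 2)

/-- The Riemannian distance on `M̃`: the infimum of lengths of C¹ curves joining `p` to `q`. -/
def wDist (m : ℝ → ℝ) (p q : ℝ × ℝ) : ℝ :=
  sInf {L : ℝ | ∃ c : ℝ → ℝ × ℝ, ∃ b : ℝ, 0 ≤ b ∧ ContDiff ℝ 1 c ∧
    c 0 = p ∧ c b = q ∧ L = wLength m c 0 b}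

/-- `γ = (t(s), θ(s))` is a unit-speed geodesic of the warped product metric:
`t'' = m(t) m'(t) θ'²`, `m(t)² θ'` is constant, and `t'² + m(t)² θ'² = 1`. -/
def IsUnitGeodesic (m : ℝ → ℝ) (γ : ℝ → ℝ × ℝ) : Prop :=
  ContDiff ℝ 2 γ ∧
  (∀ s, deriv (deriv fun u => (γ u).1) s =
      m (γ s).1 * deriv m (γ s).1 * (deriv (fun u => (γ u).2) s) ^ 2) ∧
  (∃ ν : ℝ, ∀ s, m (γ s).1 ^ 2 * deriv (fun u => (γ u).2) s = ν) ∧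
  (∀ s, (deriv (fun u => (γ u).1) s) ^ 2 +
      m (γ s).1 ^ 2 * (deriv (fun u => (γ u).2) s) ^ 2 = 1)

/-- `ν` is the Clairaut constant of the geodesic `γ`: `m(t(s))² θ'(s) = ν` for all `s`. -/
def HasClairaut (m : ℝ → ℝ) (γ : ℝ → ℝ × ℝ) (ν : ℝ) : Prop :=
  ∀ s, m (γ s).1 ^ 2 * deriv (fun u => (γ u).2) s = ν

/-- The (unit-speed) geodesic segment `γ|[0,a]` is minimal: its length `a` equals
the distance between its endpoints. -/
def IsMinimalSeg (m : ℝ → ℝ) (γ : ℝ → ℝ × ℝ) (a : ℝ) : Prop :=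
  wDist m (γ 0) (γ a) = a

/-- `x` is a cut point of `p`: the endpoint of some minimal geodesic segment from `p`
no extension of which is minimal. -/
def IsCutPoint (m : ℝ → ℝ) (p x : ℝ × ℝ) : Prop :=
  ∃ γ : ℝ → ℝ × ℝ, ∃ a : ℝ, IsUnitGeodesic m γ ∧ γ 0 = p ∧ 0 < a ∧ γ a = x ∧
    IsMinimalSeg m γ a ∧ ∀ ε > 0, ¬ IsMinimalSeg m γ (a + ε)

/-- The cut locus of `p` in `M̃`. -/
def cutLocus (m : ℝ → ℝ) (p : ℝ × ℝ) : Set (ℝ × ℝ) := {x | IsCutPoint m p x}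

/-- The Gaussian curvature `K(t) = -m''(t)/m(t)` of the warped product metric. -/
def gaussK (m : ℝ → ℝ) (t : ℝ) : ℝ := -(deriv (deriv m) t) / m t

/-- `ξ(ν) := min {t > 0 | m t = ν}`. -/
def xi (m : ℝ → ℝ) (ν : ℝ) : ℝ := sInf {t : ℝ | 0 < t ∧ m t = ν}

/-- `φ(ν) := 2∫₀^{ξ(ν)} ν / (m(t) √(m(t)² - ν²)) dt`. -/
def phi (m : ℝ → ℝ) (ν : ℝ) : ℝ :=
  2 * ∫ t in (0:ℝ)..(xi m ν), ν / (m t * Real.sqrt ((m t) ^ 2 - ν ^ 2))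

/-- `l(ν) := 2∫_{-ξ(ν)}^{0} m(t) / √(m(t)² - ν²) dt`. -/
def ell (m : ℝ → ℝ) (ν : ℝ) : ℝ :=
  2 * ∫ t in (-(xi m ν))..(0:ℝ), m t / Real.sqrt ((m t) ^ 2 - ν ^ 2)

/-- `inf m`. -/
def infm (m : ℝ → ℝ) : ℝ := ⨅ t : ℝ, m t

/-- `t₀ := sup {t > 0 | m'(t) < 0}`. -/
def tZero (m : ℝ → ℝ) : ℝ := sSup {t : ℝ | 0 < t ∧ deriv m t < 0}

/-- The covering projection from `M̃ = ℝ²` to the cylinder `M = ℝ × S¹`,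
where the angular coordinate is taken modulo `2π`. -/
def proj (p : ℝ × ℝ) : ℝ × Real.Angle := (p.1, (p.2 : Real.Angle))

/-- The Riemannian distance on the cylinder `M`: the infimum of lengths of curves
joining the two points, computed via lifts to `M̃`. -/
def cylDist (m : ℝ → ℝ) (P Q : ℝ × Real.Angle) : ℝ :=
  sInf {L : ℝ | ∃ p q : ℝ × ℝ, proj p = P ∧ proj q = Q ∧ L = wDist m p q}

/-- A unit-speed geodesic of the cylinder `M` is the projection of a unit-speed
geodesic of `M̃`. -/
def IsCylGeodesic (m : ℝ → ℝ) (γ : ℝ → ℝ × Real.Angle) : Prop :=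
  ∃ γ' : ℝ → ℝ × ℝ, IsUnitGeodesic m γ' ∧ γ = fun s => proj (γ' s)

/-- The (unit-speed) geodesic segment `γ|[0,a]` in `M` is minimal. -/
def IsCylMinimalSeg (m : ℝ → ℝ) (γ : ℝ → ℝ × Real.Angle) (a : ℝ) : Prop :=
  cylDist m (γ 0) (γ a) = a

/-- The cut locus of the point `P` on the cylinder `M`. -/
def cylCutLocus (m : ℝ → ℝ) (P : ℝ × Real.Angle) : Set (ℝ × Real.Angle) :=
  {X | ∃ γ : ℝ → ℝ × Real.Angle, ∃ a : ℝ, IsCylGeodesic m γ ∧ γ 0 = P ∧ 0 < a ∧ γ a = X ∧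
    IsCylMinimalSeg m γ a ∧ ∀ ε > 0, ¬ IsCylMinimalSeg m γ (a + ε)}


/-! ### Elementary calculus helpers -/

theorem hd_cast {f g : ℝ → ℝ} {a b x : ℝ} (h : HasDerivAt f a x) (hfg : ∀ y, g y = f y)
    (hab : b = a) : HasDerivAt g b x := by
  have : g = f := funext hfg
  rw [this, hab]; exact h

theorem le_of_hasDerivAt_nonneg {f f' : ℝ → ℝ} {a b : ℝ} (hab : a ≤ b)
    (hc : ContinuousOn f (Icc a b)) (hd : ∀ x ∈ Ioo a b, HasDerivAt f (f' x) x)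
    (hn : ∀ x ∈ Ioo a b, 0 ≤ f' x) : f a ≤ f b := by
  rcases hab.eq_or_lt with rfl | h
  · exact le_rfl
  obtain ⟨c, hc', he⟩ := exists_hasDerivAt_eq_slope f f' h hc hd
  have h1 := hn c hc'
  rw [he] at h1
  have h2 : 0 < b - a := by linarith
  have := (div_nonneg_iff.1 h1)
  rcases this with h3 | h3 <;> linarith [h3.1, h3.2]

theorem lt_of_hasDerivAt_pos {f f' : ℝ → ℝ} {a b : ℝ} (h : a < b)
    (hc : ContinuousOn f (Icc a b)) (hd : ∀ x ∈ Ioo a b, HasDerivAt f (f' x) x)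
    (hn : ∀ x ∈ Ioo a b, 0 < f' x) : f a < f b := by
  obtain ⟨c, hc', he⟩ := exists_hasDerivAt_eq_slope f f' h hc hd
  have h1 := hn c hc'
  rw [he] at h1
  have h2 : 0 < b - a := by linarith
  have := (div_pos_iff.1 h1)
  rcases this with h3 | h3 <;> linarith [h3.1, h3.2]

theorem eq_of_hasDerivAt_zero {f : ℝ → ℝ} {a b : ℝ} (hab : a ≤ b)
    (hc : ContinuousOn f (Icc a b)) (hd : ∀ x ∈ Ioo a b, HasDerivAt f 0 x) : f a = f b := by
  apply le_antisymm
  · exact le_of_hasDerivAt_nonneg (f' := fun _ => 0) hab hc hd (fun _ _ => le_rfl)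
  · have := le_of_hasDerivAt_nonneg (f := fun x => - f x) (f' := fun _ => 0) hab hc.neg
      (fun x hx => hd_cast (hd x hx).neg (fun _ => rfl) (by simp)) (fun _ _ => le_rfl)
    simpa using this

/-! ### The auxiliary function `aF ν v = √(v²-ν²) - ν arccos (ν/v)` -/

def aF (ν v : ℝ) : ℝ := √(v ^ 2 - ν ^ 2) - ν * arccos (ν / v)

theorem aF_eq_zero {ν v : ℝ} (hv : 0 < v) (h : v ≤ ν) : aF ν v = 0 := by
  unfold aF
  rw [Real.sqrt_eq_zero_of_nonpos (by nlinarith), Real.arccos_of_one_le ((one_le_div hv).2 h)]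
  simp

theorem sqrt_one_sub_div {ν v : ℝ} (hv : 0 < v) :
    √(1 - (ν / v) ^ 2) = √(v ^ 2 - ν ^ 2) / v := by
  have : 1 - (ν / v) ^ 2 = (v ^ 2 - ν ^ 2) / v ^ 2 := by field_simp
  rw [this, Real.sqrt_div' _ (by positivity), Real.sqrt_sq hv.le]

theorem hasDerivAt_arccos_div_v {ν v : ℝ} (hν : 0 < ν) (h : ν < v) :
    HasDerivAt (fun v => arccos (ν / v)) (ν / (v * √(v ^ 2 - ν ^ 2))) v := by
  have hv : 0 < v := hν.trans h
  have h1 : ν / v < 1 := (div_lt_one hv).2 h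
  have h0 : 0 < ν / v := by positivity
  have hd : HasDerivAt (fun v => ν / v) (-ν / v ^ 2) v := by
    have := (hasDerivAt_const v ν).div (hasDerivAt_id v) hv.ne'
    exact hd_cast this (fun _ => rfl) (by simp)
  have := (Real.hasDerivAt_arccos (x := ν / v) (by linarith) h1.ne).comp v hd
  refine hd_cast this (fun _ => rfl) ?_
  rw [sqrt_one_sub_div hv]
  have hs : 0 < √(v ^ 2 - ν ^ 2) := Real.sqrt_pos.2 (by nlinarith)
  field_simp

theorem hasDerivAt_aF_v_ne {ν v : ℝ} (hν : 0 < ν) (hv : 0 < v) (hne : v ≠ ν) :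
    HasDerivAt (fun v => aF ν v) (√(1 - (ν / v) ^ 2)) v := by
  rcases lt_or_gt_of_ne hne with h | h
  · have hz : √(1 - (ν / v) ^ 2) = 0 := by
      apply Real.sqrt_eq_zero_of_nonpos
      have : 1 ≤ ν / v := (one_le_div hv).2 h.le
      nlinarith
    rw [hz]
    have : (fun v => aF ν v) =ᶠ[nhds v] fun _ => 0 := by
      filter_upwards [Ioo_mem_nhds hv h] with y hy
      exact aF_eq_zero hy.1 hy.2.le
    exact (hasDerivAt_const v (0:ℝ)).congr_of_eventuallyEq this
  · have hs : 0 < v ^ 2 - ν ^ 2 := by nlinarith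
    have hs' : 0 < √(v ^ 2 - ν ^ 2) := Real.sqrt_pos.2 hs
    have h1 : HasDerivAt (fun v => √(v ^ 2 - ν ^ 2)) (2 * v / (2 * √(v ^ 2 - ν ^ 2))) v := by
      have := ((hasDerivAt_id v).pow 2).sub_const (ν ^ 2)
      have := this.sqrt hs.ne'
      exact hd_cast this (fun _ => by simp) (by simp)
    have h2 := h1.sub ((hasDerivAt_arccos_div_v hν h).const_mul ν)
    refine hd_cast h2 (fun _ => rfl) ?_
    rw [sqrt_one_sub_div hv]
    field_simp
    rw [Real.sq_sqrt hs.le]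

theorem hasDerivAt_aF_nu_ne {ν v : ℝ} (hν : 0 < ν) (hv : 0 < v) (hne : ν ≠ v) :
    HasDerivAt (fun ν => aF ν v) (- arccos (ν / v)) ν := by
  rcases lt_or_gt_of_ne hne with h | h
  · have hs : 0 < v ^ 2 - ν ^ 2 := by nlinarith
    have hs' : 0 < √(v ^ 2 - ν ^ 2) := Real.sqrt_pos.2 hs
    have h1 : HasDerivAt (fun ν => √(v ^ 2 - ν ^ 2)) (-(2 * ν) / (2 * √(v ^ 2 - ν ^ 2))) ν := by
      have := ((hasDerivAt_id ν).pow 2).const_sub (v ^ 2)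
      have := this.sqrt hs.ne'
      exact hd_cast this (fun _ => by simp) (by simp)
    have hlt : ν / v < 1 := (div_lt_one hv).2 h
    have h0 : 0 < ν / v := by positivity
    have h2 : HasDerivAt (fun ν => arccos (ν / v)) (-(1 / √(1 - (ν / v) ^ 2)) * (1 / v)) ν := by
      have := (Real.hasDerivAt_arccos (x := ν / v) (by linarith) hlt.ne).comp ν
        ((hasDerivAt_id ν).div_const v)
      exact this
    have h3 := h1.sub ((hasDerivAt_id ν).mul h2)
    refine hd_cast h3 (fun _ => rfl) ?_
    rw [sqrt_one_sub_div hv]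
    simp only [id]
    field_simp
    ring
  · rw [Real.arccos_of_one_le ((one_le_div hv).2 h.le), neg_zero]
    have : (fun ν => aF ν v) =ᶠ[nhds ν] fun _ => 0 := by
      filter_upwards [Ioi_mem_nhds h] with y hy
      exact aF_eq_zero hv (le_of_lt hy)
    exact (hasDerivAt_const ν (0:ℝ)).congr_of_eventuallyEq this

/-- Removable point: derivative everywhere on `(0,∞)`. -/
theorem hasDerivAt_pos_of_ne {f g : ℝ → ℝ} {x₀ : ℝ} (hx₀ : 0 < x₀)
    (hd : ∀ y, 0 < y → y ≠ x₀ → HasDerivAt f (g y) y) (hf : ContinuousAt f x₀)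
    (hg : ContinuousAt g x₀) : HasDerivAt f (g x₀) x₀ := by
  have he : rexp (Real.log x₀) = x₀ := Real.exp_log hx₀
  have h1 : HasDerivAt (fun y => f (rexp y)) (g (rexp (Real.log x₀)) * rexp (Real.log x₀))
      (Real.log x₀) := by
    apply hasDerivAt_of_hasDerivAt_of_ne (f := fun y => f (rexp y))
      (g := fun y => g (rexp y) * rexp y)
    · intro y hy
      have hne : rexp y ≠ x₀ := fun h => hy (by rw [← h, Real.log_exp])
      exact (hd _ (Real.exp_pos y) hne).comp y (Real.hasDerivAt_exp y)
    · exact ContinuousAt.comp (f := rexp) (g := f) (by rw [he]; exact hf) Real.continuous_exp.continuousAt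
    · exact (ContinuousAt.comp (f := rexp) (g := g) (by rw [he]; exact hg)
        Real.continuous_exp.continuousAt).mul Real.continuous_exp.continuousAt
  have h2 := h1.comp x₀ (Real.hasDerivAt_log hx₀.ne')
  rw [he] at h2
  have h3 : HasDerivAt f (g x₀ * x₀ * x₀⁻¹) x₀ := by
    apply h2.congr_of_eventuallyEq
    filter_upwards [Ioi_mem_nhds hx₀] with y hy
    simp [Real.exp_log hy]
  refine hd_cast h3 (fun _ => rfl) ?_
  field_simp

theorem hasDerivAt_aF_v {ν v : ℝ} (hν : 0 < ν) (hv : 0 < v) :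
    HasDerivAt (fun v => aF ν v) (√(1 - (ν / v) ^ 2)) v := by
  by_cases hne : v = ν
  · subst hne
    apply hasDerivAt_pos_of_ne (g := fun y => √(1 - (v / y) ^ 2)) hν
    · intro y hy hy'
      exact hasDerivAt_aF_v_ne hν hy hy'
    · unfold aF
      have : ContinuousAt (fun y => v / y) v := continuousAt_const.div continuousAt_id hv.ne'
      exact (by fun_prop : ContinuousAt (fun y => √(y ^ 2 - v ^ 2)) v).sub
        (continuousAt_const.mul (Real.continuous_arccos.continuousAt.comp this))
    · have : ContinuousAt (fun y => v / y) v := continuousAt_const.div continuousAt_id hv.ne'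
      exact ((continuousAt_const.sub (this.pow 2)).sqrt)
  · exact hasDerivAt_aF_v_ne hν hv hne

theorem hasDerivAt_aF_nu {ν v : ℝ} (hν : 0 < ν) (hv : 0 < v) :
    HasDerivAt (fun ν => aF ν v) (- arccos (ν / v)) ν := by
  by_cases hne : ν = v
  · subst hne
    apply hasDerivAt_pos_of_ne (g := fun y => - arccos (y / ν)) hν
    · intro y hy hy'
      exact hasDerivAt_aF_nu_ne hy hv hy'
    · unfold aF
      have : Continuous fun y => √(ν ^ 2 - y ^ 2) - y * arccos (y / ν) := by
        have := Real.continuous_arccos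
        fun_prop
      exact this.continuousAt
    · have : Continuous fun y => - arccos (y / ν) := by
        have := Real.continuous_arccos
        fun_prop
      exact this.continuousAt
  · exact hasDerivAt_aF_nu_ne hν hv hne


/-! ### Convexity of the action in the Clairaut constant -/

/-- Hypotheses on the warping function on an interval `[c0,u]` where it is increasing. -/
structure WPack (m m1 m2 : ℝ → ℝ) (c0 u : ℝ) : Prop where
  d1 : ∀ x, HasDerivAt m (m1 x) x
  d2 : ∀ x, HasDerivAt m1 (m2 x) x
  cont2 : Continuous m2
  pos : ∀ x, 0 < m x
  inc : ∀ x ∈ Icc c0 u, 0 < m1 x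
  key : ∀ x y, c0 ≤ x → x ≤ y → y ≤ u →
    m1 x ^ 2 * (m u ^ 2 - m y ^ 2) ≤ m1 y ^ 2 * (m u ^ 2 - m x ^ 2)

namespace WPack

variable {m m1 m2 : ℝ → ℝ} {c0 u : ℝ}

theorem contm (P : WPack m m1 m2 c0 u) : Continuous m :=
  continuous_iff_continuousAt.2 fun x => (P.d1 x).continuousAt

theorem contm1 (P : WPack m m1 m2 c0 u) : Continuous m1 :=
  continuous_iff_continuousAt.2 fun x => (P.d2 x).continuousAt

theorem smono (P : WPack m m1 m2 c0 u) {x y : ℝ} (hx : c0 ≤ x) (hxy : x < y) (hy : y ≤ u) :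
    m x < m y :=
  lt_of_hasDerivAt_pos hxy P.contm.continuousOn (fun z _ => P.d1 z)
    (fun z hz => P.inc z ⟨by linarith [hz.1], by linarith [hz.2]⟩)

theorem mono (P : WPack m m1 m2 c0 u) {x y : ℝ} (hx : c0 ≤ x) (hxy : x ≤ y) (hy : y ≤ u) :
    m x ≤ m y := by
  rcases hxy.eq_or_lt with rfl | h
  · exact le_rfl
  · exact (P.smono hx h hy).le

theorem contOn_quot (P : WPack m m1 m2 c0 u) {A : ℝ → ℝ} (hA : Continuous A) {x : ℝ}
    (hx : x ∈ Icc c0 u) : ContinuousOn (fun y => A y * m2 y / m1 y ^ 2) (uIcc c0 x) := by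
  rw [uIcc_of_le hx.1]
  apply ContinuousOn.div (hA.mul P.cont2).continuousOn (P.contm1.pow 2).continuousOn
  intro y hy
  have := P.inc y ⟨hy.1, hy.2.trans hx.2⟩
  exact pow_ne_zero 2 this.ne'

theorem ibp_int_deriv (P : WPack m m1 m2 c0 u) {A : ℝ → ℝ} (hA : Continuous A) {x : ℝ}
    (hx : x ∈ Icc c0 u) :
    HasDerivAt (fun x => ∫ y in c0..x, A y * m2 y / m1 y ^ 2) (A x * m2 x / m1 x ^ 2) x := by
  apply intervalIntegral.integral_hasDerivAt_right
  · exact (P.contOn_quot hA hx).intervalIntegrable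
  · have : Measurable (fun y => A y * m2 y / m1 y ^ 2) :=
      (hA.mul P.cont2).measurable.div (P.contm1.pow 2).measurable
    exact this.stronglyMeasurable.stronglyMeasurableAtFilter
  · have := P.inc x hx
    exact ContinuousAt.div (hA.mul P.cont2).continuousAt (P.contm1.pow 2).continuousAt
      (by positivity)

theorem ibp_cont (P : WPack m m1 m2 c0 u) {A : ℝ → ℝ} (hA : Continuous A) {x : ℝ}
    (hx : x ∈ Icc c0 u) :
    ContinuousAt (fun x => A x / m1 x + ∫ y in c0..x, A y * m2 y / m1 y ^ 2) x := by
  have := P.inc x hx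
  exact (hA.continuousAt.div P.contm1.continuousAt this.ne').add (P.ibp_int_deriv hA hx).continuousAt

theorem ibp_deriv (P : WPack m m1 m2 c0 u) {A : ℝ → ℝ} (hA : Continuous A) {x A' : ℝ}
    (hx : x ∈ Icc c0 u) (hd : HasDerivAt A A' x) :
    HasDerivAt (fun x => A x / m1 x + ∫ y in c0..x, A y * m2 y / m1 y ^ 2) (A' / m1 x) x := by
  have h1 := P.inc x hx
  refine hd_cast ((hd.div (P.d2 x) h1.ne').add (P.ibp_int_deriv hA hx)) (fun _ => rfl) ?_
  field_simp
  ring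

end WPack

def psiF (m m1 m2 : ℝ → ℝ) (c0 ν x : ℝ) : ℝ :=
  arccos (ν / m x) / m1 x + ∫ y in c0..x, arccos (ν / m y) * m2 y / m1 y ^ 2

def bF (m m1 m2 : ℝ → ℝ) (c0 ν x : ℝ) : ℝ :=
  aF ν (m x) / m1 x + ∫ y in c0..x, aF ν (m y) * m2 y / m1 y ^ 2

namespace WPack

variable {m m1 m2 : ℝ → ℝ} {c0 u : ℝ}

theorem cont_arccos (P : WPack m m1 m2 c0 u) (ν : ℝ) : Continuous fun y => arccos (ν / m y) :=
  Real.continuous_arccos.comp (continuous_const.div P.contm fun x => (P.pos x).ne')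

theorem cont_aF (P : WPack m m1 m2 c0 u) {ν : ℝ} (hν : 0 < ν) : Continuous fun y => aF ν (m y) :=
  continuous_iff_continuousAt.2 fun x =>
    ContinuousAt.comp (f := m) (g := fun v => aF ν v) (hasDerivAt_aF_v hν (P.pos x)).continuousAt
      P.contm.continuousAt

theorem psi_cont (P : WPack m m1 m2 c0 u) (ν : ℝ) {x : ℝ} (hx : x ∈ Icc c0 u) :
    ContinuousAt (psiF m m1 m2 c0 ν) x := P.ibp_cont (P.cont_arccos ν) hx

theorem psi_deriv (P : WPack m m1 m2 c0 u) {ν : ℝ} (hν : 0 < ν) {x : ℝ} (hx : x ∈ Icc c0 u)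
    (h : ν < m x) :
    HasDerivAt (psiF m m1 m2 c0 ν) (ν / (m x * √(m x ^ 2 - ν ^ 2))) x := by
  have h1 := P.inc x hx
  have := P.ibp_deriv (P.cont_arccos ν) hx
    (HasDerivAt.comp x (h₂ := fun v => arccos (ν / v)) (h := m) (hasDerivAt_arccos_div_v hν h) (P.d1 x))
  refine hd_cast this (fun _ => rfl) ?_
  field_simp

theorem b_deriv (P : WPack m m1 m2 c0 u) {ν : ℝ} (hν : 0 < ν) {x : ℝ} (hx : x ∈ Icc c0 u) :
    HasDerivAt (bF m m1 m2 c0 ν) (√(1 - (ν / m x) ^ 2)) x := by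
  have h1 := P.inc x hx
  have := P.ibp_deriv (P.cont_aF hν) hx
    (HasDerivAt.comp x (h₂ := fun v => aF ν v) (h := m) (hasDerivAt_aF_v hν (P.pos x)) (P.d1 x))
  refine hd_cast this (fun _ => rfl) ?_
  field_simp

theorem psi_zero (P : WPack m m1 m2 c0 u) {x : ℝ} (hx : x ∈ Icc c0 u) {ν : ℝ} (h : m x ≤ ν) :
    psiF m m1 m2 c0 ν x = 0 := by
  have hz : ∀ y ∈ uIcc c0 x, arccos (ν / m y) = 0 := by
    intro y hy
    rw [uIcc_of_le hx.1] at hy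
    exact Real.arccos_of_one_le ((one_le_div (P.pos y)).2 ((P.mono hy.1 hy.2 hx.2).trans h))
  unfold psiF
  rw [hz x right_mem_uIcc, intervalIntegral.integral_congr (g := fun _ => (0:ℝ))]
  · simp
  · intro y hy
    simp [hz y hy]

theorem b_zero (P : WPack m m1 m2 c0 u) {x : ℝ} (hx : x ∈ Icc c0 u) {ν : ℝ} (h : m x ≤ ν) :
    bF m m1 m2 c0 ν x = 0 := by
  have hz : ∀ y ∈ uIcc c0 x, aF ν (m y) = 0 := by
    intro y hy
    rw [uIcc_of_le hx.1] at hy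
    exact aF_eq_zero (P.pos y) ((P.mono hy.1 hy.2 hx.2).trans h)
  unfold bF
  rw [hz x right_mem_uIcc, intervalIntegral.integral_congr (g := fun _ => (0:ℝ))]
  · simp
  · intro y hy
    simp [hz y hy]

theorem b_nu (P : WPack m m1 m2 c0 u) {ν : ℝ} (hν : 0 < ν) (hcu : c0 ≤ u) :
    HasDerivAt (fun ν => bF m m1 m2 c0 ν u) (- psiF m m1 m2 c0 ν u) ν := by
  have hu : u ∈ Icc c0 u := ⟨hcu, le_rfl⟩
  have hmeas : ∀ A : ℝ → ℝ, Continuous A →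
      MeasureTheory.AEStronglyMeasurable (fun y => A y * m2 y / m1 y ^ 2)
        (MeasureTheory.volume.restrict (uIoc c0 u)) := fun A hA =>
    ((hA.mul P.cont2).measurable.div (P.contm1.pow 2).measurable).aestronglyMeasurable
  have h := intervalIntegral.hasDerivAt_integral_of_dominated_loc_of_deriv_le
    (μ := MeasureTheory.volume) (a := c0) (b := u) (x₀ := ν) (s := Ioi 0)
    (F := fun ν y => aF ν (m y) * m2 y / m1 y ^ 2)
    (F' := fun ν y => (- arccos (ν / m y)) * m2 y / m1 y ^ 2)
    (bound := fun y => |π * m2 y / m1 y ^ 2|) (Ioi_mem_nhds hν)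
    (by
      filter_upwards [Ioi_mem_nhds hν] with n hn
      exact hmeas _ (P.cont_aF hn))
    (P.contOn_quot (P.cont_aF hν) hu).intervalIntegrable
    (hmeas _ (P.cont_arccos ν).neg)
    (by
      refine Filter.Eventually.of_forall fun y _ n _ => ?_
      rw [Real.norm_eq_abs, abs_div, abs_mul, abs_div, abs_mul]
      have h1 : |-arccos (n / m y)| ≤ |π| := by
        rw [abs_neg, abs_of_nonneg (Real.arccos_nonneg _), abs_of_pos Real.pi_pos]
        exact Real.arccos_le_pi _
      exact div_le_div_of_nonneg_right (mul_le_mul_of_nonneg_right h1 (abs_nonneg _)) (abs_nonneg _))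
    (P.contOn_quot (A := fun _ => π) continuous_const hu).abs.intervalIntegrable
    (by
      refine Filter.Eventually.of_forall fun y _ n hn => ?_
      exact ((hasDerivAt_aF_nu hn (P.pos y)).mul_const _).div_const _)
  have h2 := ((hasDerivAt_aF_nu hν (P.pos u)).div_const (m1 u)).add h.2
  refine hd_cast h2 (fun _ => rfl) ?_
  unfold psiF
  have : ∀ y, -arccos (ν / m y) * m2 y / m1 y ^ 2 = -(arccos (ν / m y) * m2 y / m1 y ^ 2) := by
    intro y; ring
  simp only [this, intervalIntegral.integral_neg]
  ring

/-- A continuous inverse of `m` on `[m c0, m u]`. -/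
theorem exists_inv (P : WPack m m1 m2 c0 u) (hcu : c0 ≤ u) :
    ∃ e : ℝ → ℝ, ContinuousOn e (Icc (m c0) (m u)) ∧
      (∀ v ∈ Icc (m c0) (m u), e v ∈ Icc c0 u ∧ m (e v) = v) := by
  have hs : StrictMonoOn m (Icc c0 u) := fun x hx y hy hxy => P.smono hx.1 hxy hy.2
  have him : m '' Icc c0 u = Icc (m c0) (m u) := by
    apply Subset.antisymm
    · rintro _ ⟨x, hx, rfl⟩
      exact ⟨P.mono le_rfl hx.1 hx.2, P.mono hx.1 hx.2 le_rfl⟩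
    · exact intermediate_value_Icc hcu P.contm.continuousOn
  have hcl : ContinuousOn (Function.invFunOn m (Icc c0 u)) (m '' Icc c0 u) := by
    rw [continuousOn_iff_continuous_domRestrict]
    have : OrdConnected (m '' Icc c0 u) := by rw [him]; exact ordConnected_Icc
    have h := (hs.orderIso m (Icc c0 u)).symm.toHomeomorph.continuous
    have : (m '' Icc c0 u).domRestrict (Function.invFunOn m (Icc c0 u)) =
        fun v => (((hs.orderIso m (Icc c0 u)).symm v : Icc c0 u) : ℝ) := by
      funext v
      obtain ⟨x, rfl⟩ := (hs.orderIso m (Icc c0 u)).surjective v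
      rw [OrderIso.symm_apply_apply]
      apply hs.injOn
      · exact Function.invFunOn_mem ⟨x, x.2, rfl⟩
      · exact x.2
      · exact Function.invFunOn_eq ⟨x, x.2, rfl⟩
    rw [this]
    exact continuous_subtype_val.comp h
  refine ⟨Function.invFunOn m (Icc c0 u), by rwa [him] at hcl, ?_⟩
  intro v hv
  rw [← him] at hv
  exact ⟨Function.invFunOn_mem hv, Function.invFunOn_eq hv⟩

end WPack


def vvF (ν V l : ℝ) : ℝ := 1 / √((1 - l) / ν ^ 2 + l / V ^ 2)

theorem vvF_arg_pos {ν V l : ℝ} (hν : 0 < ν) (hV : 0 < V) (hl : l ∈ Icc (0:ℝ) 1) :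
    0 < (1 - l) / ν ^ 2 + l / V ^ 2 := by
  rcases hl.1.eq_or_lt with h | h
  · rw [← h]; simp; positivity
  · have : 0 ≤ 1 - l := by linarith [hl.2]
    positivity

theorem vvF_pos {ν V l : ℝ} (hν : 0 < ν) (hV : 0 < V) (hl : l ∈ Icc (0:ℝ) 1) : 0 < vvF ν V l :=
  div_pos one_pos (Real.sqrt_pos.2 (vvF_arg_pos hν hV hl))

theorem vvF_sq {ν V l : ℝ} (hν : 0 < ν) (hV : 0 < V) (hl : l ∈ Icc (0:ℝ) 1) :
    vvF ν V l ^ 2 * ((1 - l) / ν ^ 2 + l / V ^ 2) = 1 := by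
  have h := vvF_arg_pos hν hV hl
  unfold vvF
  rw [div_pow, Real.sq_sqrt h.le, one_pow, one_div_mul_cancel h.ne']

theorem vvF_sub_nu {ν V l : ℝ} (hν : 0 < ν) (hV : 0 < V) (hl : l ∈ Icc (0:ℝ) 1) :
    vvF ν V l ^ 2 - ν ^ 2 = vvF ν V l ^ 2 * ν ^ 2 * (l * (1 / ν ^ 2 - 1 / V ^ 2)) := by
  have h := vvF_sq hν hV hl
  have e : ν ^ 2 * (1 / ν ^ 2) = 1 := by field_simp
  linear_combination ν ^ 2 * h - vvF ν V l ^ 2 * e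

theorem vvF_sub_V {ν V l : ℝ} (hν : 0 < ν) (hV : 0 < V) (hl : l ∈ Icc (0:ℝ) 1) :
    V ^ 2 - vvF ν V l ^ 2 = vvF ν V l ^ 2 * V ^ 2 * ((1 - l) * (1 / ν ^ 2 - 1 / V ^ 2)) := by
  have h := vvF_sq hν hV hl
  have e : V ^ 2 * (1 / V ^ 2) = 1 := by field_simp
  linear_combination -V ^ 2 * h + vvF ν V l ^ 2 * e

theorem vvF_mem {ν V l : ℝ} (hν : 0 < ν) (hV : ν ≤ V) (hl : l ∈ Icc (0:ℝ) 1) :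
    vvF ν V l ∈ Icc ν V := by
  have hV0 : 0 < V := hν.trans_le hV
  have hd : 0 ≤ 1 / ν ^ 2 - 1 / V ^ 2 := by
    rw [sub_nonneg]; gcongr
  have h1 := vvF_sub_nu hν hV0 hl
  have h2 := vvF_sub_V hν hV0 hl
  have hp := vvF_pos hν hV0 hl
  have hl0 := hl.1
  have hl1 : 0 ≤ 1 - l := by linarith [hl.2]
  constructor
  · have : 0 ≤ vvF ν V l ^ 2 - ν ^ 2 := by rw [h1]; positivity
    exact le_of_sq_le_sq (by linarith) hp.le
  · have : 0 ≤ V ^ 2 - vvF ν V l ^ 2 := by rw [h2]; positivity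
    exact le_of_sq_le_sq (by linarith) hV0.le

theorem vvF_deriv {ν V l : ℝ} (hν : 0 < ν) (hV : 0 < V) (hl : l ∈ Icc (0:ℝ) 1) :
    HasDerivAt (fun l => vvF ν V l) ((1 / ν ^ 2 - 1 / V ^ 2) / 2 * vvF ν V l ^ 3) l := by
  have h := vvF_arg_pos hν hV hl
  have h1 : HasDerivAt (fun l => (1 - l) / ν ^ 2 + l / V ^ 2) (-1 / ν ^ 2 + 1 / V ^ 2) l :=
    (((hasDerivAt_id l).const_sub 1).div_const _).add ((hasDerivAt_id l).div_const _)
  have h2 := (hasDerivAt_const l (1:ℝ)).div (h1.sqrt h.ne') (Real.sqrt_pos.2 h).ne'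
  refine hd_cast h2 (fun _ => rfl) ?_
  unfold vvF
  have hs := Real.sqrt_pos.2 h
  generalize √((1 - l) / ν ^ 2 + l / V ^ 2) = s at *
  field_simp
  ring

theorem vvF_mono {ν₁ ν₂ V l : ℝ} (hν : 0 < ν₁) (h12 : ν₁ ≤ ν₂) (hV : 0 < V)
    (hl : l ∈ Icc (0:ℝ) 1) : vvF ν₁ V l ≤ vvF ν₂ V l := by
  have h2 := vvF_arg_pos (hν.trans_le h12) hV hl
  have hl1 : 0 ≤ 1 - l := by linarith [hl.2]
  unfold vvF
  apply one_div_le_one_div_of_le (Real.sqrt_pos.2 h2)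
  apply Real.sqrt_le_sqrt
  gcongr

theorem vvF_zero {ν V : ℝ} (hν : 0 < ν) : vvF ν V 0 = ν := by
  unfold vvF
  rw [sub_zero, zero_div, add_zero, Real.sqrt_div zero_le_one, Real.sqrt_sq hν.le]
  simp

theorem vvF_one {ν V : ℝ} (hV : 0 < V) : vvF ν V 1 = V := by
  unfold vvF
  rw [sub_self, zero_div, zero_add, Real.sqrt_div zero_le_one, Real.sqrt_sq hV.le]
  simp

namespace WPack

variable {m m1 m2 : ℝ → ℝ} {c0 u : ℝ}

theorem inv_deriv (P : WPack m m1 m2 c0 u) {e : ℝ → ℝ}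
    (hc : ContinuousOn e (Icc (m c0) (m u)))
    (he : ∀ v ∈ Icc (m c0) (m u), e v ∈ Icc c0 u ∧ m (e v) = v) {v : ℝ}
    (hv : v ∈ Ioo (m c0) (m u)) : HasDerivAt e (m1 (e v))⁻¹ v := by
  have hn : Icc (m c0) (m u) ∈ nhds v := Icc_mem_nhds hv.1 hv.2
  apply HasDerivAt.of_local_left_inverse (f := m) (hc.continuousAt hn) (P.d1 _)
    (P.inc _ (he v ⟨hv.1.le, hv.2.le⟩).1).ne'
  filter_upwards [hn] with y hy
  exact (he y hy).2

theorem psi_path (P : WPack m m1 m2 c0 u) {e : ℝ → ℝ}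
    (hc : ContinuousOn e (Icc (m c0) (m u)))
    (he : ∀ v ∈ Icc (m c0) (m u), e v ∈ Icc c0 u ∧ m (e v) = v) {ν : ℝ}
    (h1 : m c0 ≤ ν) (h2 : ν < m u) :
    ContinuousOn (fun l => psiF m m1 m2 c0 ν (e (vvF ν (m u) l))) (Icc 0 1) ∧
    ∀ l ∈ Ioo (0:ℝ) 1, HasDerivAt (fun l => psiF m m1 m2 c0 ν (e (vvF ν (m u) l)))
      (vvF ν (m u) l * √(1 / ν ^ 2 - 1 / m u ^ 2) / (2 * √l * m1 (e (vvF ν (m u) l)))) l := by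
  have hν : 0 < ν := (P.pos c0).trans_le h1
  have hV := P.pos u
  have hmem : ∀ l ∈ Icc (0:ℝ) 1, vvF ν (m u) l ∈ Icc (m c0) (m u) := fun l hl =>
    ⟨h1.trans (vvF_mem hν h2.le hl).1, (vvF_mem hν h2.le hl).2⟩
  constructor
  · have c1 : ContinuousOn (fun l => vvF ν (m u) l) (Icc 0 1) := fun l hl =>
      (vvF_deriv hν hV hl).continuousAt.continuousWithinAt
    have c2 : ContinuousOn (psiF m m1 m2 c0 ν) (Icc c0 u) := fun x hx =>
      (P.psi_cont ν hx).continuousWithinAt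
    exact c2.comp (hc.comp c1 hmem) (fun l hl => (he _ (hmem l hl)).1)
  · intro l hl
    have hl' : l ∈ Icc (0:ℝ) 1 := ⟨hl.1.le, hl.2.le⟩
    have hvp := vvF_pos hν hV hl'
    have hd : 0 < 1 / ν ^ 2 - 1 / m u ^ 2 := by
      rw [sub_pos]; gcongr
    have hl1 : 0 < 1 - l := by linarith [hl.2]
    have hl0 := hl.1
    have e1 := vvF_sub_nu hν hV hl'
    have e2 := vvF_sub_V hν hV hl'
    have hgt : ν < vvF ν (m u) l := by
      have : 0 < vvF ν (m u) l ^ 2 - ν ^ 2 := by rw [e1]; positivity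
      exact lt_of_pow_lt_pow_left₀ 2 hvp.le (by linarith)
    have hlt : vvF ν (m u) l < m u := by
      have : 0 < m u ^ 2 - vvF ν (m u) l ^ 2 := by rw [e2]; positivity
      exact lt_of_pow_lt_pow_left₀ 2 hV.le (by linarith)
    have hev := he _ (hmem l hl')
    have hm1 := P.inc _ hev.1
    have D1 := vvF_deriv hν hV hl'
    have D2 := P.inv_deriv hc he (v := vvF ν (m u) l) ⟨h1.trans_lt hgt, hlt⟩
    have D3 := P.psi_deriv hν hev.1 (by rw [hev.2]; exact hgt)
    have D := D3.comp l (D2.comp l D1)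
    refine hd_cast D (fun _ => rfl) ?_
    rw [hev.2, e1]
    have hs : √(vvF ν (m u) l ^ 2 * ν ^ 2 * (l * (1 / ν ^ 2 - 1 / m u ^ 2))) =
        vvF ν (m u) l * ν * (√l * √(1 / ν ^ 2 - 1 / m u ^ 2)) := by
      rw [Real.sqrt_mul (by positivity), Real.sqrt_mul hl0.le, ← mul_pow,
        Real.sqrt_sq (by positivity)]
    rw [hs]
    have hdd : (1 / ν ^ 2 - 1 / m u ^ 2) = √(1 / ν ^ 2 - 1 / m u ^ 2) ^ 2 :=
      (Real.sq_sqrt hd.le).symm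
    have hsd := Real.sqrt_pos.2 hd
    have hsl := Real.sqrt_pos.2 hl0
    generalize √(1 / ν ^ 2 - 1 / m u ^ 2) = d at *
    rw [hdd]
    field_simp

theorem psi_anti (P : WPack m m1 m2 c0 u) (hcu : c0 ≤ u) {ν₁ ν₂ : ℝ}
    (h1 : m c0 ≤ ν₁) (h12 : ν₁ < ν₂) (h2 : ν₂ < m u) :
    psiF m m1 m2 c0 ν₂ u ≤ psiF m m1 m2 c0 ν₁ u := by
  obtain ⟨e, hc, he⟩ := P.exists_inv hcu
  have hν : 0 < ν₁ := (P.pos c0).trans_le h1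
  have hν2 : 0 < ν₂ := hν.trans h12
  have hV := P.pos u
  obtain ⟨c1, d1⟩ := P.psi_path hc he h1 (h12.trans h2)
  obtain ⟨c2, d2⟩ := P.psi_path hc he (h1.trans h12.le) h2
  have heu : e (m u) = u := by
    have := he (m u) ⟨P.mono le_rfl hcu le_rfl, le_rfl⟩
    rcases this.1.2.eq_or_lt with h | h
    · exact h
    · have := P.smono this.1.1 h le_rfl
      linarith [(he (m u) ⟨P.mono le_rfl hcu le_rfl, le_rfl⟩).2]
  have key := le_of_hasDerivAt_nonneg (a := 0) (b := 1) zero_le_one (c1.sub c2)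
    (fun l hl => (d1 l hl).sub (d2 l hl)) (by
      intro l hl
      have hl' : l ∈ Icc (0:ℝ) 1 := ⟨hl.1.le, hl.2.le⟩
      have m1' := vvF_mem hν (h12.trans h2).le hl'
      have m2' := vvF_mem hν2 h2.le hl'
      have hv12 := vvF_mono hν h12.le hV hl'
      have e1 := he (vvF ν₁ (m u) l) ⟨h1.trans m1'.1, m1'.2⟩
      have e2 := he (vvF ν₂ (m u) l) ⟨(h1.trans h12.le).trans m2'.1, m2'.2⟩
      have s1 := vvF_sub_V hν hV hl'
      have s2 := vvF_sub_V hν2 hV hl'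
      have p1 := vvF_pos hν hV hl'
      have p2 := vvF_pos hν2 hV hl'
      have q1 : 0 < 1 / ν₁ ^ 2 - 1 / m u ^ 2 := by
        rw [sub_pos]
        have := h12.trans h2
        gcongr
      have q2 : 0 < 1 / ν₂ ^ 2 - 1 / m u ^ 2 := by
        rw [sub_pos]
        gcongr
      generalize vvF ν₁ (m u) l = v₁ at *
      generalize vvF ν₂ (m u) l = v₂ at *
      have ht : e v₁ ≤ e v₂ := by
        by_contra hlt
        push Not at hlt
        have := P.smono e2.1.1 hlt e1.1.2
        rw [e1.2, e2.2] at this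
        linarith
      have hk := P.key _ _ e1.1.1 ht e2.1.2
      rw [e1.2, e2.2, s1, s2] at hk
      have n1 := P.inc _ e1.1
      have n2 := P.inc _ e2.1
      have hsl := Real.sqrt_pos.2 hl.1
      rw [sub_nonneg]
      have hl1 : 0 < 1 - l := by linarith [hl.2]
      have r1 := Real.sq_sqrt q1.le
      have r2 := Real.sq_sqrt q2.le
      have r1' := Real.sqrt_pos.2 q1
      have r2' := Real.sqrt_pos.2 q2
      rw [← r1, ← r2] at hk
      generalize √(1 / ν₁ ^ 2 - 1 / m u ^ 2) = D₁ at *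
      generalize √(1 / ν₂ ^ 2 - 1 / m u ^ 2) = D₂ at *
      have hk2 : (m1 (e v₁) * (v₂ * D₂)) ^ 2 ≤ (m1 (e v₂) * (v₁ * D₁)) ^ 2 := by
        have hpos : 0 < m u ^ 2 * (1 - l) := by positivity
        apply le_of_mul_le_mul_right _ hpos
        calc _ = m1 (e v₁) ^ 2 * (v₂ ^ 2 * m u ^ 2 * ((1 - l) * D₂ ^ 2)) := by ring
          _ ≤ _ := hk
          _ = _ := by ring
      have hk3 := le_of_sq_le_sq hk2 (by positivity)
      rw [div_le_div_iff₀ (by positivity) (by positivity)]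
      nlinarith)
  simp only [Pi.sub_apply, vvF_zero hν, vvF_zero hν2, vvF_one hV, heu] at key
  have z1 := he ν₁ ⟨h1, (h12.trans h2).le⟩
  have z2 := he ν₂ ⟨h1.trans h12.le, h2.le⟩
  rw [P.psi_zero z1.1 z1.2.le, P.psi_zero z2.1 z2.2.le] at key
  linarith

end WPack

/-- The action integral started at the turning height `c`. -/
def fF (m : ℝ → ℝ) (c u : ℝ) : ℝ := ∫ y in c..u, √(1 - (m c / m y) ^ 2)

namespace WPack

variable {m m1 m2 : ℝ → ℝ} {c0 u : ℝ}

theorem f_eq_b (P : WPack m m1 m2 c0 u) {c : ℝ} (hc : c ∈ Icc c0 u) :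
    fF m c u = bF m m1 m2 c0 (m c) u := by
  unfold fF
  rw [intervalIntegral.integral_eq_sub_of_hasDerivAt (f := bF m m1 m2 c0 (m c))]
  · rw [P.b_zero hc le_rfl, sub_zero]
  · intro x hx
    rw [uIcc_of_le hc.2] at hx
    exact P.b_deriv (P.pos c) ⟨hc.1.trans hx.1, hx.2⟩
  · apply Continuous.intervalIntegrable
    exact (continuous_const.sub
      ((continuous_const.div P.contm fun x => (P.pos x).ne').pow 2)).sqrt

theorem f_nonneg (m : ℝ → ℝ) {c u : ℝ} (h : c ≤ u) : 0 ≤ fF m c u :=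
  intervalIntegral.integral_nonneg h (fun _ _ => Real.sqrt_nonneg _)

theorem psi_nonneg (P : WPack m m1 m2 c0 u) {τ : ℝ} (hτ : τ ∈ Icc c0 u) :
    0 ≤ psiF m m1 m2 c0 (m τ) u := by
  have := le_of_hasDerivAt_nonneg (f := psiF m m1 m2 c0 (m τ)) hτ.2
    (fun x hx => (P.psi_cont (m τ) ⟨hτ.1.trans hx.1, hx.2⟩).continuousWithinAt)
    (fun x hx => P.psi_deriv (P.pos τ) ⟨hτ.1.trans hx.1.le, hx.2.le⟩
      (P.smono hτ.1 hx.1 hx.2.le)) (by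
      intro x hx
      have := P.pos x
      have := P.pos τ
      positivity)
  rwa [P.psi_zero hτ le_rfl] at this

/-- The supporting line inequality. -/
theorem support (P : WPack m m1 m2 c0 u) {τ c : ℝ} (hτ : τ ∈ Icc c0 u) (hc : c ∈ Icc c0 u) :
    fF m τ u + (m τ - m c) * psiF m m1 m2 c0 (m τ) u ≤ fF m c u := by
  have hcu : c0 ≤ u := hτ.1.trans hτ.2
  rcases hτ.2.eq_or_lt with rfl | hlt
  · rw [P.psi_zero hτ le_rfl]
    have := f_nonneg m hc.2
    simp [fF] at this ⊢
    exact this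
  have hmu := P.smono hτ.1 hlt le_rfl
  rw [P.f_eq_b hτ, P.f_eq_b hc]
  have hcont : ∀ a b, 0 < a → ContinuousOn (fun ν => bF m m1 m2 c0 ν u) (Icc a b) :=
    fun a b ha x hx => (P.b_nu (ha.trans_le hx.1) hcu).continuousAt.continuousWithinAt
  rcases lt_trichotomy c τ with h | h | h
  · have hm := P.smono hc.1 h hτ.2
    obtain ⟨ξ, hξ, he⟩ := exists_hasDerivAt_eq_slope (fun ν => bF m m1 m2 c0 ν u)
      (fun ν => - psiF m m1 m2 c0 ν u) hm (hcont _ _ (P.pos c))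
      (fun x hx => P.b_nu ((P.pos c).trans hx.1) hcu)
    have ha := P.psi_anti hcu ((P.mono le_rfl hc.1 hc.2).trans hξ.1.le) hξ.2 hmu
    have hp : 0 < m τ - m c := by linarith
    rw [eq_div_iff hp.ne'] at he
    nlinarith
  · subst h; simp
  · have hm := P.smono hτ.1 h hc.2
    obtain ⟨ξ, hξ, he⟩ := exists_hasDerivAt_eq_slope (fun ν => bF m m1 m2 c0 ν u)
      (fun ν => - psiF m m1 m2 c0 ν u) hm (hcont _ _ (P.pos τ))
      (fun x hx => P.b_nu ((P.pos τ).trans hx.1) hcu)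
    have ha := P.psi_anti hcu (P.mono le_rfl hτ.1 hτ.2) hξ.1
      (hξ.2.trans_le (P.mono hc.1 hc.2 le_rfl))
    have hp : 0 < m c - m τ := by linarith
    rw [eq_div_iff hp.ne'] at he
    nlinarith

end WPack


structure Setup (m m1 m2 : ℝ → ℝ) : Prop where
  d1 : ∀ x, HasDerivAt m (m1 x) x
  d2 : ∀ x, HasDerivAt m1 (m2 x) x
  cont2 : Continuous m2
  pos : ∀ x, 0 < m x
  even : ∀ x, m (-x) = m x
  odd1 : ∀ x, m1 (-x) = - m1 x
  even2 : ∀ x, m2 (-x) = m2 x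
  curv : ∀ x y, 0 ≤ x → x ≤ y → m2 x / m x ≤ m2 y / m y
  neg0 : m2 0 < 0

namespace Setup

variable {m m1 m2 : ℝ → ℝ}

theorem contm (S : Setup m m1 m2) : Continuous m :=
  continuous_iff_continuousAt.2 fun x => (S.d1 x).continuousAt

theorem contm1 (S : Setup m m1 m2) : Continuous m1 :=
  continuous_iff_continuousAt.2 fun x => (S.d2 x).continuousAt

theorem m1_zero (S : Setup m m1 m2) : m1 0 = 0 := by
  have := S.odd1 0
  rw [neg_zero] at this
  linarith

theorem curv_neg (S : Setup m m1 m2) {x y : ℝ} (hxy : x ≤ y) (hy : y ≤ 0) :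
    m2 y / m y ≤ m2 x / m x := by
  have := S.curv (-y) (-x) (by linarith) (by linarith)
  rwa [S.even, S.even, S.even2, S.even2] at this

theorem wpackA (S : Setup m m1 m2) {c0 u : ℝ} (hu : u ≤ 0) (hinc : ∀ x ∈ Icc c0 u, 0 < m1 x) :
    WPack m m1 m2 c0 u := by
  refine ⟨S.d1, S.d2, S.cont2, S.pos, hinc, ?_⟩
  intro x y hx hxy hy
  set k : ℝ := - (m2 y / m y) with hk
  have hg : ∀ z, HasDerivAt (fun z => m1 z ^ 2 + k * m z ^ 2)
      (2 * (m1 z * m z * (m2 z / m z + k))) z := by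
    intro z
    have := ((S.d2 z).pow 2).add (((S.d1 z).pow 2).const_mul k)
    refine hd_cast this (fun _ => rfl) ?_
    have := (S.pos z).ne'
    field_simp
    push_cast
    ring
  have hgc : Continuous (fun z => m1 z ^ 2 + k * m z ^ 2) :=
    (S.contm1.pow 2).add (continuous_const.mul (S.contm.pow 2))
  have h1 : m1 x ^ 2 + k * m x ^ 2 ≤ m1 y ^ 2 + k * m y ^ 2 := by
    refine le_of_hasDerivAt_nonneg hxy hgc.continuousOn (fun z _ => hg z) ?_
    intro z hz
    have a1 := hinc z ⟨by linarith [hz.1], by linarith [hz.2]⟩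
    have a2 := S.pos z
    have a3 := S.curv_neg (x := z) (y := y) hz.2.le (by linarith)
    have : 0 ≤ m2 z / m z + k := by rw [hk]; linarith
    positivity
  have h2 : m1 u ^ 2 + k * m u ^ 2 ≤ m1 y ^ 2 + k * m y ^ 2 := by
    have := le_of_hasDerivAt_nonneg (f := fun z => - (m1 z ^ 2 + k * m z ^ 2)) hy
      hgc.neg.continuousOn (fun z _ => (hg z).neg) ?_
    · linarith
    intro z hz
    have a1 := hinc z ⟨by linarith [hz.1], by linarith [hz.2]⟩
    have a2 := S.pos z
    have a3 := S.curv_neg (x := y) (y := z) hz.1.le (by linarith [hz.2])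
    have : 0 ≤ -(m2 z / m z + k) := by rw [hk]; linarith
    have := mul_nonneg (mul_pos a1 a2).le this
    linarith
  have mono : ∀ a b, c0 ≤ a → a ≤ b → b ≤ u → m a ≤ m b := fun a b ha hab hb =>
    le_of_hasDerivAt_nonneg hab S.contm.continuousOn (fun z _ => S.d1 z)
      (fun z hz => (hinc z ⟨by linarith [hz.1], by linarith [hz.2]⟩).le)
  have A : 0 ≤ m u ^ 2 - m y ^ 2 := by
    have := mono y u (by linarith) hy le_rfl
    nlinarith [S.pos y, S.pos u]
  have B : 0 ≤ m y ^ 2 - m x ^ 2 := by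
    have := mono x y hx hxy hy
    nlinarith [S.pos y, S.pos x]
  have e1 : m1 x ^ 2 * (m u ^ 2 - m y ^ 2) ≤
      (m1 y ^ 2 + k * (m y ^ 2 - m x ^ 2)) * (m u ^ 2 - m y ^ 2) :=
    mul_le_mul_of_nonneg_right (by linarith) A
  have e2 : (m y ^ 2 - m x ^ 2) * (k * (m u ^ 2 - m y ^ 2)) ≤
      (m y ^ 2 - m x ^ 2) * m1 y ^ 2 :=
    mul_le_mul_of_nonneg_left (by linarith [sq_nonneg (m1 u)]) B
  linarith

theorem wpackB (S : Setup m m1 m2) {c0 u : ℝ} (hinc : ∀ x ∈ Icc c0 u, 0 < m1 x)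
    (h2 : ∀ x ∈ Icc c0 u, 0 ≤ m2 x) :
    WPack m m1 m2 c0 u := by
  refine ⟨S.d1, S.d2, S.cont2, S.pos, hinc, ?_⟩
  intro x y hx hxy hy
  have h1 : m1 x ≤ m1 y :=
    le_of_hasDerivAt_nonneg hxy S.contm1.continuousOn (fun z _ => S.d2 z)
      (fun z hz => h2 z ⟨by linarith [hz.1], by linarith [hz.2]⟩)
  have mono : ∀ a b, c0 ≤ a → a ≤ b → b ≤ u → m a ≤ m b := fun a b ha hab hb =>
    le_of_hasDerivAt_nonneg hab S.contm.continuousOn (fun z _ => S.d1 z)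
      (fun z hz => (hinc z ⟨by linarith [hz.1], by linarith [hz.2]⟩).le)
  have A : 0 ≤ m u ^ 2 - m y ^ 2 := by
    have := mono y u (by linarith) hy le_rfl
    nlinarith [S.pos y, S.pos u]
  have B : 0 ≤ m y ^ 2 - m x ^ 2 := by
    have := mono x y hx hxy hy
    nlinarith [S.pos y, S.pos x]
  have hx0 := hinc x ⟨hx, by linarith⟩
  have e : m1 x ^ 2 ≤ m1 y ^ 2 := by nlinarith
  have e1 := mul_le_mul_of_nonneg_right e A
  have e2 := mul_nonneg (sq_nonneg (m1 y)) B
  linarith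

/-- The structure of the sign of `m'`. -/
theorem dichotomy (S : Setup m m1 m2) :
    (∀ x, x < 0 → 0 < m1 x) ∨
    ∃ t0, 0 < t0 ∧ (∀ x, -t0 < x → x < 0 → 0 < m1 x) ∧ m1 t0 = 0 ∧ (∀ x, t0 < x → 0 < m1 x) ∧
      (∀ x, t0 ≤ x → 0 ≤ m2 x) := by
  by_cases hZ : ∀ x, 0 < x → m1 x < 0
  · left
    intro x hx
    have := hZ (-x) (by linarith)
    rw [S.odd1] at this; linarith
  right
  push Not at hZ
  obtain ⟨z, hz0, hz⟩ := hZ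
  -- near zero m1 < 0
  obtain ⟨δ, hδ, hδm⟩ : ∃ δ > 0, ∀ x, 0 < x → x < δ → m1 x < 0 := by
    have hn : ∀ᶠ x in nhds (0:ℝ), m2 x < 0 := S.cont2.continuousAt.eventually (gt_mem_nhds S.neg0)
    obtain ⟨δ, hδ, h⟩ := Metric.eventually_nhds_iff.1 hn
    refine ⟨δ, hδ, fun x hx hxd => ?_⟩
    have := lt_of_hasDerivAt_pos (f := fun y => - m1 y) hx S.contm1.neg.continuousOn
      (fun y _ => (S.d2 y).neg) (fun y hy => by
        have := h (y := y) (by rw [Real.dist_eq, sub_zero, abs_of_pos hy.1]; linarith [hy.2])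
        linarith)
    simp only [S.m1_zero] at this; linarith
  set Z : Set ℝ := {x | δ ≤ x ∧ 0 ≤ m1 x} with hZdef
  have hZc : IsClosed Z := (isClosed_le continuous_const continuous_id).inter
    (isClosed_le continuous_const S.contm1)
  have hzZ : z ∈ Z := ⟨by by_contra h; push Not at h; linarith [hδm z hz0 h], hz⟩
  have hbdd : BddBelow Z := ⟨δ, fun x hx => hx.1⟩
  have ht0 : sInf Z ∈ Z := hZc.csInf_mem ⟨z, hzZ⟩ hbdd
  set t0 := sInf Z with ht0def
  have hpos : 0 < t0 := lt_of_lt_of_le hδ ht0.1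
  have hlt : ∀ x, 0 < x → x < t0 → m1 x < 0 := by
    intro x hx hxt
    by_contra h
    push Not at h
    have : x ∈ Z := ⟨by by_contra h'; push Not at h'; linarith [hδm x hx h'], h⟩
    linarith [csInf_le hbdd this]
  have hzero : m1 t0 = 0 := by
    apply le_antisymm _ ht0.2
    have hcl : t0 ∈ closure (Ioo 0 t0) := by
      rw [closure_Ioo hpos.ne]; exact ⟨hpos.le, le_rfl⟩
    have := closure_minimal (s := Ioo 0 t0) (t := {x | m1 x ≤ 0}) (fun x hx => (hlt x hx.1 hx.2).le)
      (isClosed_le S.contm1 continuous_const)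
    exact this hcl
  have h2 : 0 < m2 t0 := by
    by_contra h
    push Not at h
    have hneg : ∀ x ∈ Ioo (t0 / 2) t0, 0 ≤ - m2 x := by
      intro x hx
      have h1 := S.curv x t0 (by linarith [hx.1]) hx.2.le
      have h3 : m2 t0 / m t0 ≤ 0 := div_nonpos_of_nonpos_of_nonneg h (S.pos _).le
      have h4 : m2 x / m x ≤ 0 := h1.trans h3
      have := (div_le_iff₀ (S.pos x)).1 h4
      linarith
    have := le_of_hasDerivAt_nonneg (f := fun y => - m1 y) (a := t0 / 2) (b := t0) (by linarith)
      S.contm1.neg.continuousOn (fun y _ => (S.d2 y).neg) hneg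
    simp only [hzero] at this
    linarith [hlt (t0 / 2) (by linarith) (by linarith)]
  have h2' : ∀ x, t0 ≤ x → 0 < m2 x := by
    intro x hx
    have h1 := S.curv t0 x hpos.le hx
    have h3 : 0 < m2 t0 / m t0 := div_pos h2 (S.pos _)
    have h4 : 0 < m2 x / m x := lt_of_lt_of_le h3 h1
    exact (div_pos_iff_of_pos_right (S.pos x)).1 h4
  refine ⟨t0, hpos, ?_, hzero, ?_, fun x hx => (h2' x hx).le⟩
  · intro x hx hx0
    have := hlt (-x) (by linarith) (by linarith)
    rw [S.odd1] at this; linarith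
  · intro x hx
    have := lt_of_hasDerivAt_pos (f := m1) hx S.contm1.continuousOn (fun y _ => S.d2 y)
      (fun y hy => h2' y hy.1.le)
    rwa [hzero] at this

end Setup


theorem cs_point {a n y z σ : ℝ} (hσ : σ ^ 2 ≤ 1) (hn : 0 < n) (ha : 0 ≤ a) (han : a ≤ n) :
    a * z + σ * (√(1 - (a / n) ^ 2) * y) ≤ √(y ^ 2 + n ^ 2 * z ^ 2) := by
  apply Real.le_sqrt_of_sq_le
  have hr : (a / n) ^ 2 ≤ 1 := by
    rw [div_pow, div_le_one (by positivity)]; nlinarith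
  have hs : √(1 - (a / n) ^ 2) ^ 2 = 1 - (a / n) ^ 2 := Real.sq_sqrt (by linarith)
  set w := √(1 - (a / n) ^ 2)
  set r := a / n with hrdef
  have hr' : a = r * n := by rw [hrdef]; field_simp
  rw [hr']
  have h1 : (r * n * z + σ * (w * y)) ^ 2 + (r * (σ * y) - w * (n * z)) ^ 2
      = (r ^ 2 + w ^ 2) * (σ ^ 2 * y ^ 2 + n ^ 2 * z ^ 2) := by ring
  rw [hs] at h1
  nlinarith [sq_nonneg (r * (σ * y) - w * (n * z)), sq_nonneg y]

def HF (m : ℝ → ℝ) (ν x : ℝ) : ℝ := ∫ y in (0:ℝ)..x, √(1 - (ν / m y) ^ 2)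

theorem cont_sq {m : ℝ → ℝ} (hm : Continuous m) (hp : ∀ x, 0 < m x) (ν : ℝ) :
    Continuous fun y => √(1 - (ν / m y) ^ 2) :=
  (continuous_const.sub ((continuous_const.div hm fun x => (hp x).ne').pow 2)).sqrt

theorem HF_deriv {m : ℝ → ℝ} (hm : Continuous m) (hp : ∀ x, 0 < m x) (ν x : ℝ) :
    HasDerivAt (HF m ν) (√(1 - (ν / m x) ^ 2)) x :=
  intervalIntegral.integral_hasDerivAt_right ((cont_sq hm hp ν).intervalIntegrable _ _)
    (cont_sq hm hp ν).stronglyMeasurable.stronglyMeasurableAtFilter (cont_sq hm hp ν).continuousAt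

theorem HF_sub {m : ℝ → ℝ} (hm : Continuous m) (hp : ∀ x, 0 < m x) (ν x y : ℝ) :
    HF m ν y - HF m ν x = ∫ z in x..y, √(1 - (ν / m z) ^ 2) :=
  intervalIntegral.integral_interval_sub_left ((cont_sq hm hp ν).intervalIntegrable _ _)
    ((cont_sq hm hp ν).intervalIntegrable _ _)

theorem HF_mono {m : ℝ → ℝ} (hm : Continuous m) (hp : ∀ x, 0 < m x) (ν : ℝ) {x y : ℝ} (h : x ≤ y) :
    HF m ν x ≤ HF m ν y := by
  have := HF_sub hm hp ν x y
  have h2 : 0 ≤ ∫ z in x..y, √(1 - (ν / m z) ^ 2) :=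
    intervalIntegral.integral_nonneg h fun _ _ => Real.sqrt_nonneg _
  linarith

theorem HF_odd {m : ℝ → ℝ} (he : ∀ x, m (-x) = m x) (ν x : ℝ) : HF m ν (-x) = - HF m ν x := by
  unfold HF
  have := intervalIntegral.integral_comp_neg (a := 0) (b := x) (fun y => √(1 - (ν / m y) ^ 2))
  simp only [he, neg_zero] at this
  rw [this, intervalIntegral.integral_symm]

theorem fF_le_HF {m : ℝ → ℝ} (hm : Continuous m) (hp : ∀ x, 0 < m x) {ν c u : ℝ} (hν : 0 ≤ ν)
    (hc : ν ≤ m c) (hcu : c ≤ u) : fF m c u ≤ HF m ν u - HF m ν c := by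
  rw [HF_sub hm hp]
  apply intervalIntegral.integral_mono_on hcu ((cont_sq hm hp _).intervalIntegrable _ _)
    ((cont_sq hm hp _).intervalIntegrable _ _)
  intro x _
  apply Real.sqrt_le_sqrt
  have := hp x
  have := hp c
  gcongr

theorem speed_cont {m : ℝ → ℝ} (hm : Continuous m) {c : ℝ → ℝ × ℝ} (hc : ContDiff ℝ 1 c) :
    Continuous fun s => √((deriv (fun u => (c u).1) s) ^ 2 +
      (m (c s).1) ^ 2 * (deriv (fun u => (c u).2) s) ^ 2) := by
  have h1 : Continuous (deriv fun u => (c u).1) := hc.fst.continuous_deriv le_rfl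
  have h2 : Continuous (deriv fun u => (c u).2) := hc.snd.continuous_deriv le_rfl
  have h3 : Continuous fun s => (c s).1 := hc.continuous.fst
  exact ((h1.pow 2).add (((hm.comp h3).pow 2).mul (h2.pow 2))).sqrt

theorem curve_hd1 {c : ℝ → ℝ × ℝ} (hc : ContDiff ℝ 1 c) (s : ℝ) :
    HasDerivAt (fun u => (c u).1) (deriv (fun u => (c u).1) s) s :=
  ((hc.fst.differentiable one_ne_zero) s).hasDerivAt

theorem curve_hd2 {c : ℝ → ℝ × ℝ} (hc : ContDiff ℝ 1 c) (s : ℝ) :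
    HasDerivAt (fun u => (c u).2) (deriv (fun u => (c u).2) s) s :=
  ((hc.snd.differentiable one_ne_zero) s).hasDerivAt

theorem curve_bound {m : ℝ → ℝ} (hm : Continuous m) (hp : ∀ x, 0 < m x) {c : ℝ → ℝ × ℝ}
    (hc : ContDiff ℝ 1 c) {a b ν σ : ℝ} (hab : a ≤ b) (hν : 0 ≤ ν) (hσ : σ ^ 2 ≤ 1)
    (hle : ∀ s ∈ Icc a b, ν ≤ m (c s).1) :
    ν * ((c b).2 - (c a).2) + σ * (HF m ν (c b).1 - HF m ν (c a).1) ≤ wLength m c a b := by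
  set g : ℝ → ℝ := fun s => √((deriv (fun u => (c u).1) s) ^ 2 +
      (m (c s).1) ^ 2 * (deriv (fun u => (c u).2) s) ^ 2) with hg
  have hgc : Continuous g := speed_cont hm hc
  have hG : ∀ s, HasDerivAt (fun s => ∫ r in a..s, g r) (g s) s := fun s =>
    intervalIntegral.integral_hasDerivAt_right (hgc.intervalIntegrable _ _)
      hgc.stronglyMeasurable.stronglyMeasurableAtFilter hgc.continuousAt
  have hd : ∀ s, HasDerivAt (fun s => (∫ r in a..s, g r) - (ν * (c s).2 + σ * HF m ν (c s).1))
      (g s - (ν * deriv (fun u => (c u).2) s +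
        σ * (√(1 - (ν / m (c s).1) ^ 2) * deriv (fun u => (c u).1) s))) s := by
    intro s
    refine (hG s).sub (((curve_hd2 hc s).const_mul ν).add (HasDerivAt.const_mul σ ?_))
    exact HasDerivAt.comp s (h₂ := HF m ν) (h := fun u => (c u).1) (HF_deriv hm hp ν _) (curve_hd1 hc s)
  have := le_of_hasDerivAt_nonneg hab
    (fun s _ => (hd s).continuousAt.continuousWithinAt) (fun s _ => hd s) (fun s hs => by
      have := cs_point (y := deriv (fun u => (c u).1) s) (z := deriv (fun u => (c u).2) s) hσ
        (hp (c s).1) hν (hle s ⟨hs.1.le, hs.2.le⟩)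
      linarith)
  simp only [intervalIntegral.integral_same] at this
  unfold wLength
  linarith

theorem wLength_nonneg (m : ℝ → ℝ) (c : ℝ → ℝ × ℝ) {a b : ℝ} (h : a ≤ b) : 0 ≤ wLength m c a b :=
  intervalIntegral.integral_nonneg h fun _ _ => Real.sqrt_nonneg _

theorem wLength_add {m : ℝ → ℝ} (hm : Continuous m) {c : ℝ → ℝ × ℝ} (hc : ContDiff ℝ 1 c)
    (a b d : ℝ) : wLength m c a b + wLength m c b d = wLength m c a d :=
  intervalIntegral.integral_add_adjacent_intervals ((speed_cont hm hc).intervalIntegrable _ _)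
    ((speed_cont hm hc).intervalIntegrable _ _)

structure Geo (m m1 : ℝ → ℝ) (ν : ℝ) (t t' θ : ℝ → ℝ) : Prop where
  dt : ∀ s, HasDerivAt t (t' s) s
  dt' : ∀ s, HasDerivAt t' (ν ^ 2 * m1 (t s) / m (t s) ^ 3) s
  dθ : ∀ s, HasDerivAt θ (ν / m (t s) ^ 2) s
  en : ∀ s, t' s ^ 2 + ν ^ 2 / m (t s) ^ 2 = 1

namespace Geo
variable {m m1 m2 : ℝ → ℝ} {ν : ℝ} {t t' θ : ℝ → ℝ}

theorem contt (G : Geo m m1 ν t t' θ) : Continuous t :=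
  continuous_iff_continuousAt.2 fun x => (G.dt x).continuousAt
theorem contt' (G : Geo m m1 ν t t' θ) : Continuous t' :=
  continuous_iff_continuousAt.2 fun x => (G.dt' x).continuousAt
theorem contθ (G : Geo m m1 ν t t' θ) : Continuous θ :=
  continuous_iff_continuousAt.2 fun x => (G.dθ x).continuousAt

theorem negθ (G : Geo m m1 ν t t' θ) : Geo m m1 (-ν) t t' (fun s => - θ s) :=
  ⟨G.dt, fun s => hd_cast (G.dt' s) (fun _ => rfl) (by ring),
    fun s => hd_cast (G.dθ s).neg (fun _ => rfl) (by ring), fun s => by rw [← G.en s]; ring⟩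

theorem negt (S : Setup m m1 m2) (G : Geo m m1 ν t t' θ) :
    Geo m m1 ν (fun s => - t s) (fun s => - t' s) θ :=
  ⟨fun s => (G.dt s).neg,
    fun s => hd_cast (G.dt' s).neg (fun _ => rfl) (by simp only [S.odd1, S.even]; ring),
    fun s => hd_cast (G.dθ s) (fun _ => rfl) (by simp only [S.even]),
    fun s => by rw [← G.en s, S.even]; ring⟩

theorem shift (G : Geo m m1 ν t t' θ) (a : ℝ) :
    Geo m m1 ν (fun s => t (s + a)) (fun s => t' (s + a)) (fun s => θ (s + a)) :=
  ⟨fun s => (G.dt (s + a)).comp_add_const s a, fun s => (G.dt' (s + a)).comp_add_const s a,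
    fun s => (G.dθ (s + a)).comp_add_const s a, fun s => G.en _⟩

theorem rev (G : Geo m m1 ν t t' θ) (a : ℝ) :
    Geo m m1 ν (fun s => t (a - s)) (fun s => - t' (a - s)) (fun s => - θ (a - s)) := by
  have key : ∀ {f : ℝ → ℝ} {f' s : ℝ}, HasDerivAt f f' (a - s) →
      HasDerivAt (fun s => f (a - s)) (-f') s := fun h => h.comp_const_sub a _
  refine ⟨fun s => key (G.dt (a - s)), fun s => ?_, fun s => ?_, fun s => ?_⟩
  · exact hd_cast (key (G.dt' (a - s))).neg (fun _ => rfl) (by simp)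
  · exact hd_cast (key (G.dθ (a - s))).neg (fun _ => rfl) (by simp)
  · rw [← G.en (a - s)]; ring

/-- forward uniqueness at an equilibrium -/
theorem const_fwd (S : Setup m m1 m2) (G : Geo m m1 ν t t' θ) {s0 s1 : ℝ} (h01 : s0 ≤ s1)
    (h1 : t' s0 = 0) (h2 : m1 (t s0) = 0) : t s1 = t s0 := by
  obtain ⟨R, hR⟩ := (isCompact_Icc.image G.contt (s := Icc s0 s1)).isBounded.subset_closedBall (t s0)
  set D : Set ℝ := Metric.closedBall (t s0) R
  have hin : ∀ s ∈ Icc s0 s1, t s ∈ D := fun s hs => hR ⟨s, hs, rfl⟩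
  set q : ℝ → ℝ := fun x => ν ^ 2 * m1 x / m x ^ 3
  have hq : ∀ x, HasDerivAt q ((ν ^ 2 * m2 x * m x ^ 3 - ν ^ 2 * m1 x * (3 * m x ^ 2 * m1 x)) /
      (m x ^ 3) ^ 2) x := fun x =>
    hd_cast (((S.d2 x).const_mul (ν ^ 2)).div ((S.d1 x).pow 3) (pow_ne_zero 3 (S.pos x).ne'))
      (fun _ => rfl) (by simp)
  have hqc : Continuous fun x => (ν ^ 2 * m2 x * m x ^ 3 - ν ^ 2 * m1 x * (3 * m x ^ 2 * m1 x)) /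
      (m x ^ 3) ^ 2 := by
    have e1 := S.contm
    have e2 := S.contm1
    have e3 := S.cont2
    refine Continuous.div (by fun_prop) (by fun_prop) fun x => ?_
    have := S.pos x
    positivity
  obtain ⟨C, hC⟩ := (isCompact_closedBall (t s0) R).exists_bound_of_continuousOn hqc.continuousOn
  have hlip : ∀ x ∈ D, |q x| ≤ C * |x - t s0| := by
    intro x hx
    have h0 : t s0 ∈ D := hin s0 ⟨le_rfl, h01⟩
    have := (convex_closedBall (t s0) R).norm_image_sub_le_of_norm_hasDerivWithin_le
      (fun y _ => (hq y).hasDerivWithinAt) hC h0 hx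
    have hz : q (t s0) = 0 := by simp [q, h2]
    rw [hz, sub_zero] at this
    simpa [Real.norm_eq_abs] using this
  set A := C + 1
  have hd : ∀ s, HasDerivAt (fun s => - (((t s - t s0) ^ 2 + t' s ^ 2) * rexp (-(A * s))))
      (-((2 * (t s - t s0) * t' s + 2 * t' s * q (t s)) * rexp (-(A * s)) +
        ((t s - t s0) ^ 2 + t' s ^ 2) * (rexp (-(A * s)) * -A))) s := by
    intro s
    have a1 := (((G.dt s).sub_const (t s0)).pow 2).add ((G.dt' s).pow 2)
    have a2 := (((hasDerivAt_id s).const_mul A).neg).exp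
    exact hd_cast (a1.mul a2).neg (fun _ => rfl) (by simp [q])
  have := le_of_hasDerivAt_nonneg h01 (fun s _ => (hd s).continuousAt.continuousWithinAt)
    (fun s _ => hd s) (fun s hs => by
      have hl := hlip (t s) (hin s ⟨hs.1.le, hs.2.le⟩)
      have hC0 : 0 ≤ C := (norm_nonneg _).trans (hC _ (hin s ⟨hs.1.le, hs.2.le⟩))
      have e := Real.exp_pos (-(A * s))
      have b1 : 2 * (t s - t s0) * t' s ≤ (t s - t s0) ^ 2 + t' s ^ 2 := by
        nlinarith [sq_nonneg (t s - t s0 - t' s)]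
      have b2 : 2 * t' s * q (t s) ≤ C * ((t s - t s0) ^ 2 + t' s ^ 2) := by
        have : t' s * q (t s) ≤ |t' s| * |q (t s)| := by rw [← abs_mul]; exact le_abs_self _
        have h3 := mul_le_mul_of_nonneg_left hl (abs_nonneg (t' s))
        have h4 : 2 * (|t' s| * |t s - t s0|) ≤ (t s - t s0) ^ 2 + t' s ^ 2 := by
          rw [← sq_abs (t s - t s0), ← sq_abs (t' s)]
          nlinarith [sq_nonneg (|t s - t s0| - |t' s|)]
        have h5 := mul_le_mul_of_nonneg_left h4 hC0
        linarith
      have b3 : 0 ≤ (A * ((t s - t s0) ^ 2 + t' s ^ 2) -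
        (2 * (t s - t s0) * t' s + 2 * t' s * q (t s))) * rexp (-(A * s)) :=
        mul_nonneg (by simp only [A]; linarith) e.le
      linarith)
  simp only [h1, sub_self] at this
  have e := Real.exp_pos (-(A * s1))
  have h3 : ((t s1 - t s0) ^ 2 + t' s1 ^ 2) * rexp (-(A * s1)) ≤ 0 := by
    have h4 : (0 ^ 2 + 0 ^ 2 : ℝ) * rexp (-(A * s0)) = 0 := by ring
    linarith
  have h5 : (t s1 - t s0) ^ 2 + t' s1 ^ 2 ≤ 0 := nonpos_of_mul_nonpos_left h3 e
  have h6 : (t s1 - t s0) ^ 2 = 0 := by nlinarith [sq_nonneg (t s1 - t s0), sq_nonneg (t' s1)]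
  have := pow_eq_zero_iff (two_ne_zero) |>.1 h6
  linarith

theorem const_of_eq (S : Setup m m1 m2) (G : Geo m m1 ν t t' θ) {s0 : ℝ}
    (h1 : t' s0 = 0) (h2 : m1 (t s0) = 0) (s : ℝ) : t s = t s0 := by
  rcases le_total s0 s with h | h
  · exact G.const_fwd S h h1 h2
  · have := (G.rev s0).const_fwd S (s0 := 0) (s1 := s0 - s) (by linarith) (by simp [h1]) (by simp [h2])
    simpa using this

end Geo


namespace Geo
variable {m m1 m2 : ℝ → ℝ} {ν : ℝ} {t t' θ : ℝ → ℝ}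

theorem nu_le (S : Setup m m1 m2) (G : Geo m m1 ν t t' θ) (hν : 0 ≤ ν) (s : ℝ) : ν ≤ m (t s) := by
  have h := G.en s
  have hp := S.pos (t s)
  have h1 : ν ^ 2 / m (t s) ^ 2 ≤ 1 := by nlinarith [sq_nonneg (t' s)]
  rw [div_le_one (by positivity)] at h1
  exact (sq_le_sq₀ hν hp.le).1 h1

theorem tp_sq (G : Geo m m1 ν t t' θ) (s : ℝ) : t' s ^ 2 = 1 - (ν / m (t s)) ^ 2 := by
  rw [← G.en s]; ring

theorem tp_pos_eq (G : Geo m m1 ν t t' θ) {s : ℝ} (h : 0 ≤ t' s) :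
    t' s = √(1 - (ν / m (t s)) ^ 2) := by
  rw [← G.tp_sq s, Real.sqrt_sq h]

theorem nu_lt (S : Setup m m1 m2) (G : Geo m m1 ν t t' θ) (hν : 0 ≤ ν) {s : ℝ} (h : t' s ≠ 0) :
    ν < m (t s) := by
  refine lt_of_le_of_ne (G.nu_le S hν s) fun he => h ?_
  have h1 := G.tp_sq s
  rw [← he, div_self (by rw [he]; exact (S.pos _).ne')] at h1
  simpa using h1

theorem seg_len_pos (S : Setup m m1 m2) (G : Geo m m1 ν t t' θ) {a1 a2 : ℝ} (h12 : a1 ≤ a2)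
    (hp : ∀ s ∈ Ioo a1 a2, 0 ≤ t' s) :
    a2 - a1 = ν * (θ a2 - θ a1) + (HF m ν (t a2) - HF m ν (t a1)) := by
  have hd : ∀ s, HasDerivAt (fun s => s - ν * θ s - HF m ν (t s))
      (1 - ν * (ν / m (t s) ^ 2) - √(1 - (ν / m (t s)) ^ 2) * t' s) s := fun s =>
    ((hasDerivAt_id s).sub ((G.dθ s).const_mul ν)).sub
      (HasDerivAt.comp s (h₂ := HF m ν) (h := t) (HF_deriv S.contm S.pos ν _) (G.dt s))
  have := eq_of_hasDerivAt_zero h12 (fun s _ => (hd s).continuousAt.continuousWithinAt)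
    (fun s hs => hd_cast (hd s) (fun _ => rfl) (by
      rw [← G.tp_pos_eq (hp s hs), ← sq, G.tp_sq]; ring))
  linarith

theorem seg_len_neg (S : Setup m m1 m2) (G : Geo m m1 ν t t' θ) {a1 a2 : ℝ} (h12 : a1 ≤ a2)
    (hp : ∀ s ∈ Ioo a1 a2, t' s ≤ 0) :
    a2 - a1 = ν * (θ a2 - θ a1) - (HF m ν (t a2) - HF m ν (t a1)) := by
  have := (G.rev (a1 + a2)).seg_len_pos S h12 (fun s hs => by
    have := hp (a1 + a2 - s) ⟨by linarith [hs.2], by linarith [hs.1]⟩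
    linarith)
  simp only [add_sub_cancel_right, add_sub_cancel_left] at this
  linarith

theorem seg_ang_pos (S : Setup m m1 m2) (G : Geo m m1 ν t t' θ) (hν : 0 < ν) {a1 a2 c0 : ℝ}
    (h12 : a1 ≤ a2) (hW : ∀ s ∈ Icc a1 a2, c0 ≤ t s ∧ WPack m m1 m2 c0 (t s))
    (hp : ∀ s ∈ Ioo a1 a2, 0 < t' s) :
    θ a2 - θ a1 = psiF m m1 m2 c0 ν (t a2) - psiF m m1 m2 c0 ν (t a1) := by
  have hc : ContinuousOn (fun s => θ s - psiF m m1 m2 c0 ν (t s)) (Icc a1 a2) := by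
    intro s hs
    obtain ⟨h1, h2⟩ := hW s hs
    have := ContinuousAt.comp (f := t) (g := psiF m m1 m2 c0 ν) (h2.psi_cont ν ⟨h1, le_rfl⟩)
      G.contt.continuousAt
    exact (G.contθ.continuousAt.sub this).continuousWithinAt
  have := eq_of_hasDerivAt_zero h12 hc (fun s hs => by
    obtain ⟨h1, h2⟩ := hW s ⟨hs.1.le, hs.2.le⟩
    have hlt := G.nu_lt S hν.le (hp s hs).ne'
    have h3 := h2.psi_deriv hν ⟨h1, le_rfl⟩ hlt
    have h4 := (G.dθ s).sub (HasDerivAt.comp s (h₂ := psiF m m1 m2 c0 ν) (h := t) h3 (G.dt s))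
    refine hd_cast h4 (fun _ => rfl) ?_
    have hm := S.pos (t s)
    rw [G.tp_pos_eq (hp s hs).le, sqrt_one_sub_div hm]
    have : 0 < √(m (t s) ^ 2 - ν ^ 2) := Real.sqrt_pos.2 (by nlinarith)
    field_simp
    ring)
  linarith

theorem seg_ang_neg (S : Setup m m1 m2) (G : Geo m m1 ν t t' θ) (hν : 0 < ν) {a1 a2 c0 : ℝ}
    (h12 : a1 ≤ a2) (hW : ∀ s ∈ Icc a1 a2, c0 ≤ t s ∧ WPack m m1 m2 c0 (t s))
    (hp : ∀ s ∈ Ioo a1 a2, t' s < 0) :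
    θ a2 - θ a1 = psiF m m1 m2 c0 ν (t a1) - psiF m m1 m2 c0 ν (t a2) := by
  have := (G.rev (a1 + a2)).seg_ang_pos S hν h12
    (fun s hs => hW (a1 + a2 - s) ⟨by linarith [hs.2], by linarith [hs.1]⟩) (fun s hs => by
    have := hp (a1 + a2 - s) ⟨by linarith [hs.2], by linarith [hs.1]⟩
    linarith)
  simp only [add_sub_cancel_right, add_sub_cancel_left] at this
  linarith

theorem θ_mono (S : Setup m m1 m2) (G : Geo m m1 ν t t' θ) (hν : 0 ≤ ν) {a b : ℝ} (h : a ≤ b) :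
    θ a ≤ θ b :=
  le_of_hasDerivAt_nonneg h G.contθ.continuousOn (fun s _ => G.dθ s)
    (fun s _ => div_nonneg hν (pow_pos (S.pos _) 2).le)

/-- The three monotonicity patterns of a geodesic in a region where `m' > 0`. -/
theorem facts (S : Setup m m1 m2) (G : Geo m m1 ν t t' θ) (hν : 0 < ν) {b c0 τ : ℝ} (hb : 0 ≤ b)
    (hcτ : c0 ≤ τ) (hτ : m τ = ν)
    (hW : ∀ s ∈ Icc 0 b, τ ≤ t s ∧ WPack m m1 m2 c0 (t s)) :
    (θ b - θ 0 = psiF m m1 m2 c0 ν (t 0) + psiF m m1 m2 c0 ν (t b) ∧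
      b = ν * (θ b - θ 0) + fF m τ (t 0) + fF m τ (t b)) ∨
    (θ b - θ 0 ≤ psiF m m1 m2 c0 ν (t 0) + psiF m m1 m2 c0 ν (t b) ∧
      b ≤ ν * (θ b - θ 0) + fF m τ (t 0) + fF m τ (t b) ∧
      ∃ σ : ℝ, σ ^ 2 ≤ 1 ∧ b = ν * (θ b - θ 0) + σ * (HF m ν (t b) - HF m ν (t 0))) := by
  have hW' : ∀ s ∈ Icc 0 b, c0 ≤ t s ∧ WPack m m1 m2 c0 (t s) := fun s hs =>
    ⟨hcτ.trans (hW s hs).1, (hW s hs).2⟩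
  have hF : ∀ u, fF m τ u = HF m ν u - HF m ν τ := fun u => by
    rw [HF_sub S.contm S.pos]; unfold fF; rw [hτ]
  have hinc : ∀ s1 s2, 0 ≤ s1 → s1 < s2 → s2 ≤ b → t' s1 < t' s2 := by
    intro s1 s2 h1 h12 h2
    refine lt_of_hasDerivAt_pos h12 G.contt'.continuousOn (fun s _ => G.dt' s) ?_
    intro s hs
    obtain ⟨h3, h4⟩ := hW' s ⟨by linarith [hs.1], by linarith [hs.2]⟩
    have := h4.inc (t s) ⟨h3, le_rfl⟩
    have := S.pos (t s)
    positivity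
  have hpsi : ∀ s ∈ Icc 0 b, 0 ≤ psiF m m1 m2 c0 ν (t s) := fun s hs => by
    have := (hW s hs).2.psi_nonneg (τ := τ) ⟨hcτ, (hW s hs).1⟩
    rwa [hτ] at this
  have hH : ∀ s ∈ Icc 0 b, HF m ν τ ≤ HF m ν (t s) := fun s hs =>
    HF_mono S.contm S.pos ν (hW s hs).1
  have m0 : (0:ℝ) ∈ Icc 0 b := ⟨le_rfl, hb⟩
  have mb : b ∈ Icc 0 b := ⟨hb, le_rfl⟩
  rw [hF, hF]
  have p0 := hpsi 0 m0
  have pb := hpsi b mb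
  have q0 := hH 0 m0
  have qb := hH b mb
  by_cases c1 : 0 ≤ t' 0
  · have hp : ∀ s ∈ Ioo 0 b, 0 < t' s := fun s hs =>
      c1.trans_lt (hinc 0 s le_rfl hs.1 hs.2.le)
    have e1 := G.seg_ang_pos S hν hb hW' hp
    have e2 := G.seg_len_pos S hb (fun s hs => (hp s hs).le)
    right
    exact ⟨by linarith, by linarith, 1, by norm_num, by linarith⟩
  push Not at c1
  by_cases c2 : t' b ≤ 0
  · have hp : ∀ s ∈ Ioo 0 b, t' s < 0 := fun s hs =>
      (hinc s b hs.1.le hs.2 le_rfl).trans_le c2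
    have e1 := G.seg_ang_neg S hν hb hW' hp
    have e2 := G.seg_len_neg S hb (fun s hs => (hp s hs).le)
    right
    exact ⟨by linarith, by linarith, -1, by norm_num, by linarith⟩
  push Not at c2
  left
  obtain ⟨z, hz, hz0⟩ := intermediate_value_Icc hb G.contt'.continuousOn (show (0:ℝ) ∈ Icc (t' 0) (t' b) from
    ⟨c1.le, c2.le⟩)
  have hn : ∀ s ∈ Ioo 0 z, t' s < 0 := fun s hs => by
    rw [← hz0]; exact hinc s z hs.1.le hs.2 hz.2
  have hp : ∀ s ∈ Ioo z b, 0 < t' s := fun s hs => by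
    rw [← hz0]; exact hinc z s hz.1 hs.1 hs.2.le
  have e1 := G.seg_ang_neg S hν hz.1 (fun s hs => hW' s ⟨hs.1, hs.2.trans hz.2⟩) hn
  have e2 := G.seg_len_neg S hz.1 (fun s hs => (hn s hs).le)
  have e3 := G.seg_ang_pos S hν hz.2 (fun s hs => hW' s ⟨hz.1.trans hs.1, hs.2⟩) hp
  have e4 := G.seg_len_pos S hz.2 (fun s hs => (hp s hs).le)
  obtain ⟨hz1, hz2⟩ := hW z hz
  have hmz : m (t z) = ν := by
    have h1 := G.tp_sq z
    rw [hz0] at h1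
    have h3 := S.pos (t z)
    have h2 : (ν / m (t z)) ^ 2 = 1 := by linarith
    rw [div_pow, div_eq_one_iff_eq (by positivity)] at h2
    exact ((sq_eq_sq₀ hν.le h3.le).1 h2).symm
  have hzτ : t z = τ := by
    rcases hz1.eq_or_lt with h | h
    · exact h.symm
    · have := hz2.smono hcτ h le_rfl
      rw [hmz, hτ] at this
      exact absurd this (lt_irrefl _)
  have hpz : psiF m m1 m2 c0 ν (t z) = 0 := hz2.psi_zero ⟨hcτ.trans hz1, le_rfl⟩ hmz.le
  rw [hpz] at e1 e3
  rw [hzτ] at e2 e4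
  exact ⟨by linarith, by linarith⟩

theorem caseTwo (S : Setup m m1 m2) (G : Geo m m1 ν t t' θ) (hν : 0 < ν) {I : Set ℝ}
    (hW : ∀ c ∈ I, ∀ u ∈ I, c ≤ u → WPack m m1 m2 c u) {b : ℝ} (hb : 0 ≤ b)
    (hI : ∀ s ∈ Icc 0 b, t s ∈ I) {τ : ℝ} (hτI : τ ∈ I) (hτ : m τ = ν)
    {c : ℝ → ℝ × ℝ} (hc : ContDiff ℝ 1 c) {B : ℝ} (hB : 0 ≤ B) (hc0 : c 0 = (t 0, θ 0))
    (hcB : c B = (t b, θ b))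
    (sel : ∀ ε > 0, ∃ l ∈ I, l ≤ t 0 ∧ l ≤ t b ∧ ∃ ν' > 0, ν' ≤ m l ∧ m l ≤ ν' + ε ∧
      (∀ s ∈ Icc 0 B, ν' ≤ m (c s).1) ∧ ∃ sc ∈ Icc 0 B, ∃ σ : ℝ, σ ^ 2 ≤ 1 ∧
        fF m l (t 0) ≤ σ * (HF m ν' (c sc).1 - HF m ν' (t 0)) ∧
        fF m l (t b) ≤ σ * (HF m ν' (c sc).1 - HF m ν' (t b))) :
    b ≤ wLength m c 0 B := by
  have hτle : ∀ s ∈ Icc 0 b, τ ≤ t s := by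
    intro s hs
    by_contra h
    push Not at h
    have h1 := (hW (t s) (hI s hs) τ hτI h.le).smono le_rfl h le_rfl
    have h2 := G.nu_le S hν.le s
    rw [hτ] at h1
    linarith
  have hDθ : 0 ≤ θ b - θ 0 := sub_nonneg.2 (G.θ_mono S hν.le hb)
  have m0 : (0:ℝ) ∈ Icc 0 b := ⟨le_rfl, hb⟩
  have mb : b ∈ Icc 0 b := ⟨hb, le_rfl⟩
  by_cases hall : (∀ s ∈ Icc 0 B, ν ≤ m (c s).1) ∧
      ∃ σ : ℝ, σ ^ 2 ≤ 1 ∧ b = ν * (θ b - θ 0) + σ * (HF m ν (t b) - HF m ν (t 0))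
  · obtain ⟨h1, σ, hσ, h2⟩ := hall
    have := curve_bound S.contm S.pos hc hB hν.le hσ h1
    rw [hc0, hcB] at this
    simp only at this
    linarith
  -- main estimate, up to epsilon
  have main : ∀ ε > 0, b - ε * (θ b - θ 0) ≤ wLength m c 0 B := by
    intro ε₀ hε₀
    obtain ⟨ε, hε, hεle, hεc⟩ : ∃ ε > 0, ε ≤ ε₀ ∧ ∀ s ∈ Icc 0 B, m (c s).1 < ν → 
        ∃ s' ∈ Icc 0 B, m (c s').1 + ε ≤ ν := by
      by_cases h : ∃ s ∈ Icc 0 B, m (c s).1 < ν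
      · obtain ⟨s, hs, h⟩ := h
        exact ⟨min ε₀ (ν - m (c s).1), lt_min hε₀ (by linarith), min_le_left _ _,
          fun _ _ _ => ⟨s, hs, by linarith [min_le_right ε₀ (ν - m (c s).1)]⟩⟩
      · push Not at h
        exact ⟨ε₀, hε₀, le_rfl, fun s hs hlt => absurd hlt (not_lt.2 (h s hs))⟩
    obtain ⟨l, hlI, hl0, hlb, ν', hν', hνl, hlν, hle, sc, hsc, σ, hσ, hσ0, hσb⟩ := sel ε hε
    have L1 := curve_bound S.contm S.pos hc hsc.1 hν'.le hσ
      (fun s hs => hle s ⟨hs.1, hs.2.trans hsc.2⟩)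
    have L2 := curve_bound (σ := -σ) S.contm S.pos hc hsc.2 hν'.le (by linarith [neg_sq σ])
      (fun s hs => hle s ⟨hsc.1.trans hs.1, hs.2⟩)
    have L3 := wLength_add S.contm hc 0 sc B
    rw [hc0] at L1
    rw [hcB] at L2
    simp only at L1 L2
    have L4 : ν' * (θ b - θ 0) + fF m l (t 0) + fF m l (t b) ≤ wLength m c 0 B := by linarith
    set c0 := min l τ with hc0def
    have hc0I : c0 ∈ I := by
      rcases min_choice l τ with h | h <;> rw [hc0def, h] <;> assumption
    have hWW : ∀ s ∈ Icc 0 b, τ ≤ t s ∧ WPack m m1 m2 c0 (t s) := fun s hs =>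
      ⟨hτle s hs, hW c0 hc0I (t s) (hI s hs) ((min_le_right _ _).trans (hτle s hs))⟩
    have s0 := (hWW 0 m0).2.support (τ := τ) (c := l) ⟨min_le_right _ _, hτle 0 m0⟩
      ⟨min_le_left _ _, hl0⟩
    have sb := (hWW b mb).2.support (τ := τ) (c := l) ⟨min_le_right _ _, hτle b mb⟩
      ⟨min_le_left _ _, hlb⟩
    rw [hτ] at s0 sb
    have L5 : (m l - ε) * (θ b - θ 0) ≤ ν' * (θ b - θ 0) :=
      mul_le_mul_of_nonneg_right (by linarith) hDθ
    have L6 : ε * (θ b - θ 0) ≤ ε₀ * (θ b - θ 0) := mul_le_mul_of_nonneg_right hεle hDθ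
    rcases G.facts S hν hb (min_le_right l τ) hτ hWW with ⟨e1, e2⟩ | ⟨e1, e2, e3⟩
    · rw [← hc0def] at e1
      have e4 : (ν - m l) * (psiF m m1 m2 c0 ν (t 0) + psiF m m1 m2 c0 ν (t b)) =
        (ν - m l) * (θ b - θ 0) := by rw [e1]
      linarith
    · rw [← hc0def] at e1
      have hneg : ∃ s ∈ Icc 0 B, m (c s).1 < ν := by
        by_contra h
        push Not at h
        exact hall ⟨h, e3⟩
      obtain ⟨s1, hs1, h1⟩ := hneg
      obtain ⟨s2, hs2, h2⟩ := hεc s1 hs1 h1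
      have hml : m l ≤ ν := by linarith [hle s2 hs2]
      have e4 : (ν - m l) * (θ b - θ 0) ≤
        (ν - m l) * (psiF m m1 m2 c0 ν (t 0) + psiF m m1 m2 c0 ν (t b)) :=
        mul_le_mul_of_nonneg_left e1 (by linarith)
      linarith
  refine le_of_forall_pos_le_add fun δ hδ => ?_
  have h1 := main (δ / (θ b - θ 0 + 1)) (by positivity)
  have h2 : δ / (θ b - θ 0 + 1) * (θ b - θ 0) ≤ δ := by
    rw [div_mul_eq_mul_div, div_le_iff₀ (by linarith)]
    nlinarith
  linarith

end Geo


theorem eps_right {m : ℝ → ℝ} (hm : Continuous m) {a p q ε : ℝ} (hp : a < p) (hq : a < q)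
    (hε : 0 < ε) : ∃ l, a < l ∧ l ≤ p ∧ l ≤ q ∧ m l ≤ m a + ε := by
  have h1 : ∀ᶠ l in nhdsWithin a (Ioi a), m l < m a + ε :=
    (hm.continuousAt.eventually (gt_mem_nhds (by linarith))).filter_mono nhdsWithin_le_nhds
  have h2 : ∀ᶠ l in nhdsWithin a (Ioi a), l < p :=
    (gt_mem_nhds hp : ∀ᶠ l in nhds a, l < p).filter_mono nhdsWithin_le_nhds
  have h3 : ∀ᶠ l in nhdsWithin a (Ioi a), l < q :=
    (gt_mem_nhds hq : ∀ᶠ l in nhds a, l < q).filter_mono nhdsWithin_le_nhds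
  have h4 : ∀ᶠ l in nhdsWithin a (Ioi a), a < l := self_mem_nhdsWithin
  obtain ⟨l, a1, a2, a3, a4⟩ := (h1.and (h2.and (h3.and h4))).exists
  exact ⟨l, a4, a2.le, a3.le, a1.le⟩

theorem fold_sel {m : ℝ → ℝ} (hm : Continuous m) (hp : ∀ x, 0 < m x) (he : ∀ x, m (-x) = m x)
    {ν l x : ℝ} (hν : 0 ≤ ν) (hl : ν ≤ m l) (hx : -|x| ≤ l) :
    ∃ σ : ℝ, σ ^ 2 ≤ 1 ∧ ∀ p, l ≤ p → p ≤ 0 → fF m l p ≤ σ * (HF m ν x - HF m ν p) := by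
  by_cases h : x ≤ l
  · refine ⟨-1, by norm_num, fun p hlp _ => ?_⟩
    have := fF_le_HF hm hp hν hl hlp
    have := HF_mono hm hp ν h
    linarith
  · refine ⟨1, by norm_num, fun p hlp hp0 => ?_⟩
    have hx' : -l ≤ x := by
      rcases le_total 0 x with h0 | h0
      · rw [abs_of_nonneg h0] at hx; linarith
      · rw [abs_of_nonpos h0] at hx; push Not at h; linarith
    have h1 := fF_le_HF hm hp hν hl hlp
    have h2 := HF_mono hm hp ν hx'
    rw [HF_odd he] at h2
    have h3 := HF_mono hm hp ν hp0
    have h4 : HF m ν 0 = 0 := by simp [HF]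
    linarith

def Rf (c : ℝ → ℝ × ℝ) : ℝ → ℝ × ℝ := fun s => (-(c s).1, (c s).2)

theorem Rf_contDiff {c : ℝ → ℝ × ℝ} {n : WithTop ℕ∞} (hc : ContDiff ℝ n c) : ContDiff ℝ n (Rf c) :=
  hc.fst.neg.prodMk hc.snd

theorem Rf_wLength {m : ℝ → ℝ} (he : ∀ x, m (-x) = m x) (c : ℝ → ℝ × ℝ) (a b : ℝ) :
    wLength m (Rf c) a b = wLength m c a b := by
  unfold wLength Rf
  simp only [he, deriv.fun_neg, neg_sq]

namespace Geo
variable {m m1 m2 : ℝ → ℝ} {ν : ℝ} {t t' θ : ℝ → ℝ}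

theorem caseOne (S : Setup m m1 m2) (G : Geo m m1 ν t t' θ) (hν : 0 ≤ ν) (hall : ∀ x, ν ≤ m x)
    {b : ℝ} (hb : 0 ≤ b) {c : ℝ → ℝ × ℝ} (hc : ContDiff ℝ 1 c) {B : ℝ} (hB : 0 ≤ B)
    (hc0 : c 0 = (t 0, θ 0)) (hcB : c B = (t b, θ b)) : b ≤ wLength m c 0 B := by
  have hz : ∀ s0, t' s0 = 0 → ∀ s, t' s = 0 := by
    intro s0 h0 s
    have hmν : m (t s0) = ν := by
      by_contra h
      have h1 := G.tp_sq s0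
      have hp := S.pos (t s0)
      have h3 : ν / m (t s0) < 1 := by
        rw [div_lt_one hp]; exact lt_of_le_of_ne (hall _) (Ne.symm h)
      have h4 : 0 ≤ ν / m (t s0) := by positivity
      rw [h0] at h1
      nlinarith
    have h1 : m1 (t s0) = 0 := by
      have : IsLocalMin m (t s0) := Filter.Eventually.of_forall fun x => by rw [hmν]; exact hall x
      exact this.hasDerivAt_eq_zero (S.d1 _)
    have h2 := G.const_of_eq S h0 h1
    have h3 : t = fun _ => t s0 := funext h2
    have h4 := G.dt s
    rw [h3] at h4
    exact h4.unique (hasDerivAt_const s _)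
  have hsg : (∀ s ∈ Ioo 0 b, 0 ≤ t' s) ∨ (∀ s ∈ Ioo 0 b, t' s ≤ 0) := by
    by_contra h
    push Not at h
    obtain ⟨⟨s1, _, h1⟩, s2, _, h2⟩ := h
    obtain ⟨z, _, hz0⟩ := intermediate_value_uIcc (a := s1) (b := s2) G.contt'.continuousOn
      (show (0:ℝ) ∈ uIcc (t' s1) (t' s2) by rw [uIcc_of_le (by linarith)]; exact ⟨h1.le, h2.le⟩)
    linarith [hz z hz0 s1]
  rcases hsg with h | h
  · have e := G.seg_len_pos S hb h
    have := curve_bound (σ := 1) S.contm S.pos hc hB hν (by norm_num) (fun s _ => hall _)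
    rw [hc0, hcB] at this
    simp only at this
    linarith
  · have e := G.seg_len_neg S hb h
    have := curve_bound (σ := -1) S.contm S.pos hc hB hν (by norm_num) (fun s _ => hall _)
    rw [hc0, hcB] at this
    simp only at this
    linarith

theorem thmA_pos (S : Setup m m1 m2) (G : Geo m m1 ν t t' θ) (hν : 0 ≤ ν) {b : ℝ} (hb : 0 ≤ b)
    (hneg : ∀ s ∈ Icc 0 b, t s < 0) {c : ℝ → ℝ × ℝ} (hc : ContDiff ℝ 1 c) {B : ℝ} (hB : 0 ≤ B)
    (hc0 : c 0 = (t 0, θ 0)) (hcB : c B = (t b, θ b)) : b ≤ wLength m c 0 B := by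
  by_cases hall : ∀ x, ν ≤ m x
  · exact G.caseOne S hν hall hb hc hB hc0 hcB
  push Not at hall
  obtain ⟨x0, hx0⟩ := hall
  have hν0 : 0 < ν := (S.pos x0).trans hx0
  have m0 : (0:ℝ) ∈ Icc 0 b := ⟨le_rfl, hb⟩
  have mb : b ∈ Icc 0 b := ⟨hb, le_rfl⟩
  have hxc : Continuous fun s => (c s).1 := hc.continuous.fst
  have hx_0 : (c 0).1 = t 0 := by rw [hc0]
  have hx_B : (c B).1 = t b := by rw [hcB]
  have hm_abs : ∀ x, m (-|x|) = m x := fun x => by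
    rcases abs_choice x with h | h <;> rw [h]
    · exact S.even x
    · rw [neg_neg]
  -- minimum of the folded height
  obtain ⟨sc, hsc, hmin⟩ := isCompact_Icc.exists_isMinOn (s := Icc (0:ℝ) B) ⟨0, le_rfl, hB⟩
    (f := fun s => -|(c s).1|) (hxc.abs.neg).continuousOn
  have hminle : ∀ s ∈ Icc 0 B, -|(c sc).1| ≤ -|(c s).1| := fun s hs => hmin hs
  have hl0 : -|(c sc).1| ≤ t 0 := by
    have := hminle 0 ⟨le_rfl, hB⟩
    rw [hx_0, abs_of_neg (hneg 0 m0)] at this; linarith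
  have hlb : -|(c sc).1| ≤ t b := by
    have := hminle B ⟨hB, le_rfl⟩
    rw [hx_B, abs_of_neg (hneg b mb)] at this; linarith
  set l := -|(c sc).1| with hldef
  -- selection when the minimum lies in the region where m' > 0
  have selIn : ∀ I : Set ℝ, l ∈ I → (∀ x, l < x → x < 0 → 0 < m1 x) → 
      ∀ ε > 0, ∃ l ∈ I, l ≤ t 0 ∧ l ≤ t b ∧ ∃ ν' > 0, ν' ≤ m l ∧ m l ≤ ν' + ε ∧
      (∀ s ∈ Icc 0 B, ν' ≤ m (c s).1) ∧ ∃ sc ∈ Icc 0 B, ∃ σ : ℝ, σ ^ 2 ≤ 1 ∧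
        fF m l (t 0) ≤ σ * (HF m ν' (c sc).1 - HF m ν' (t 0)) ∧
        fF m l (t b) ≤ σ * (HF m ν' (c sc).1 - HF m ν' (t b)) := by
    intro I hlI hm1 ε hε
    obtain ⟨σ, hσ, hs⟩ := fold_sel S.contm S.pos S.even (S.pos l).le le_rfl hldef.ge
    refine ⟨l, hlI, hl0, hlb, m l, S.pos l, le_rfl, by linarith, ?_, sc, hsc, σ, hσ,
      hs _ hl0 (hneg 0 m0).le, hs _ hlb (hneg b mb).le⟩
    intro s hs
    rw [← hm_abs (c s).1]
    exact le_of_hasDerivAt_nonneg (hminle s hs) S.contm.continuousOn (fun z _ => S.d1 z)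
      (fun z hz => (hm1 z hz.1 (hz.2.trans_le (by simp))).le)
  rcases S.dichotomy with hA | ⟨T, hT, hA, hT0, hBp, hB2⟩
  · -- region (-∞, 0)
    have hmono : ∀ x y, x ≤ y → y ≤ 0 → m x ≤ m y := fun x y hxy hy =>
      le_of_hasDerivAt_nonneg hxy S.contm.continuousOn (fun z _ => S.d1 z)
        (fun z hz => (hA z (hz.2.trans_le hy)).le)
    have hν1 := G.nu_le S hν 0
    have hx0' : -|x0| ≤ t 0 := by
      by_contra h
      push Not at h
      have := hmono (t 0) (-|x0|) h.le (by simp)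
      rw [hm_abs] at this
      linarith
    obtain ⟨τ, hτ, hmτ⟩ := intermediate_value_Icc hx0' S.contm.continuousOn
      (show ν ∈ Icc (m (-|x0|)) (m (t 0)) from ⟨by rw [hm_abs]; exact hx0.le, hν1⟩)
    exact G.caseTwo S hν0 (I := Iio 0)
      (fun c _ u hu _ => S.wpackA (le_of_lt hu) (fun x hx => hA x (hx.2.trans_lt hu))) hb hneg
      (show τ ∈ Iio 0 from hτ.2.trans_lt (hneg 0 m0)) hmτ hc hB hc0 hcB
      (selIn _ (hl0.trans_lt (hneg 0 m0)) (fun x _ hx => hA x hx))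
  -- global minimum at ±T
  have hmT : m (-T) = m T := S.even T
  have hmin : ∀ x, m T ≤ m x := by
    have h1 : ∀ x, T ≤ x → m T ≤ m x := fun x hx =>
      le_of_hasDerivAt_nonneg hx S.contm.continuousOn (fun z _ => S.d1 z)
        (fun z hz => (hBp z hz.1).le)
    have h2 : ∀ x, x ≤ 0 → m T ≤ m x := by
      intro x hx
      rcases le_total x (-T) with h | h
      · rw [← S.even x]; exact h1 _ (by linarith)
      · rw [← hmT]
        exact le_of_hasDerivAt_nonneg h S.contm.continuousOn (fun z _ => S.d1 z)
          (fun z hz => (hA z hz.1 (hz.2.trans_le hx)).le)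
    intro x
    rw [← hm_abs x]; exact h2 _ (by simp)
  have hTν : m T < ν := (hmin x0).trans_lt hx0
  have hne : ∀ s, t s ≠ -T := by
    intro s h
    have := G.nu_le S hν s
    rw [h, hmT] at this
    linarith
  by_cases hreg : -T < t 0
  · have hreg' : ∀ s ∈ Icc 0 b, -T < t s := by
      intro s hs
      by_contra h
      push Not at h
      obtain ⟨z, _, hz⟩ := intermediate_value_Icc' hs.1 G.contt.continuousOn
        (show -T ∈ Icc (t s) (t 0) from ⟨h, hreg.le⟩)
      exact hne z hz
    obtain ⟨τ, hτ, hmτ⟩ := intermediate_value_Icc hreg.le S.contm.continuousOn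
      (show ν ∈ Icc (m (-T)) (m (t 0)) from ⟨by rw [hmT]; exact hTν.le, G.nu_le S hν 0⟩)
    have hτT : -T < τ := lt_of_le_of_ne hτ.1 fun h => by
      rw [← h, hmT] at hmτ; linarith
    refine G.caseTwo S hν0 (I := Ioo (-T) 0)
      (fun c hc u hu _ => S.wpackA hu.2.le
        (fun x hx => hA x (hc.1.trans_le hx.1) (hx.2.trans_lt hu.2))) hb
      (fun s hs => ⟨hreg' s hs, hneg s hs⟩)
      (⟨hτT, hτ.2.trans_lt (hneg 0 m0)⟩) hmτ hc hB hc0 hcB ?_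
    by_cases hlT : -T < l
    · exact selIn _ ⟨hlT, hl0.trans_lt (hneg 0 m0)⟩ (fun x hx => hA x (hlT.trans hx))
    push Not at hlT
    intro ε hε
    obtain ⟨k, hk1, hk2, hk3, hk4⟩ := eps_right S.contm hreg (hreg' b mb) hε
    obtain ⟨σ, hσ, hs⟩ := fold_sel (ν := m T) S.contm S.pos S.even (S.pos T).le (hmin k)
      (show -|(c sc).1| ≤ k from hlT.trans hk1.le)
    refine ⟨k, ⟨hk1, hk2.trans_lt (hneg 0 m0)⟩, hk2, hk3, m T, S.pos T, hmin k, by rwa [← hmT],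
      fun s _ => hmin _, sc, hsc, σ, hσ, hs _ hk2 (hneg 0 m0).le, hs _ hk3 (hneg b mb).le⟩
  · have hreg0 : t 0 < -T := lt_of_le_of_ne (not_lt.1 hreg) (hne 0)
    have hreg' : ∀ s ∈ Icc 0 b, t s < -T := by
      intro s hs
      by_contra h
      push Not at h
      obtain ⟨z, _, hz⟩ := intermediate_value_Icc hs.1 G.contt.continuousOn
        (show -T ∈ Icc (t 0) (t s) from ⟨hreg0.le, h⟩)
      exact hne z hz
    rw [← Rf_wLength S.even]
    have h0T : T ≤ -t 0 := by linarith
    obtain ⟨τ, hτ, hmτ⟩ := intermediate_value_Icc h0T S.contm.continuousOn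
      (show ν ∈ Icc (m T) (m (-t 0)) from ⟨hTν.le, by rw [S.even]; exact G.nu_le S hν 0⟩)
    have hτT : T < τ := lt_of_le_of_ne hτ.1 fun h => by
      rw [← h] at hmτ; linarith
    have hbT := hreg' b mb
    refine (G.negt S).caseTwo S hν0 (I := Ioi T)
      (fun c hc u hu _ => S.wpackB (fun x hx => hBp x (lt_of_lt_of_le hc hx.1))
        (fun x hx => hB2 x (le_of_lt (lt_of_lt_of_le hc hx.1)))) hb
      (fun s hs => by have := hreg' s hs; simp only [mem_Ioi]; linarith)
      hτT hmτ (Rf_contDiff hc) hB (by simp [Rf, hc0]) (by simp [Rf, hcB]) ?_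
    obtain ⟨sd, hsd, hmin2⟩ := isCompact_Icc.exists_isMinOn (s := Icc (0:ℝ) B) ⟨0, le_rfl, hB⟩
      (f := fun s => -(c s).1) (hxc.neg).continuousOn
    have hminle2 : ∀ s ∈ Icc 0 B, -(c sd).1 ≤ -(c s).1 := fun s hs => hmin2 hs
    have k0 : -(c sd).1 ≤ - t 0 := by
      have := hminle2 0 ⟨le_rfl, hB⟩
      rwa [hx_0] at this
    have kb : -(c sd).1 ≤ - t b := by
      have := hminle2 B ⟨hB, le_rfl⟩
      rwa [hx_B] at this
    intro ε hε
    simp only [Rf]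
    by_cases hlT : T < -(c sd).1
    · have hmo : ∀ y, -(c sd).1 ≤ y → m (-(c sd).1) ≤ m y := fun y hy =>
        le_of_hasDerivAt_nonneg hy S.contm.continuousOn (fun z _ => S.d1 z)
        (fun z hz => (hBp z (hlT.trans hz.1)).le)
      refine ⟨-(c sd).1, hlT, k0, kb, m (-(c sd).1), S.pos _, le_rfl, by linarith,
        fun s hs => hmo _ (hminle2 s hs), sd, hsd, -1, by norm_num, ?_, ?_⟩
      · have := fF_le_HF S.contm S.pos (S.pos _).le (le_refl (m (-(c sd).1))) k0
        linarith
      · have := fF_le_HF S.contm S.pos (S.pos _).le (le_refl (m (-(c sd).1))) kb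
        linarith
    push Not at hlT
    obtain ⟨k, hk1, hk2, hk3, hk4⟩ := eps_right (p := -t 0) (q := -t b) S.contm
      (show T < -t 0 by linarith) (show T < -t b by linarith) hε
    have hmono := HF_mono S.contm S.pos (m T) (hlT.trans hk1.le)
    refine ⟨k, hk1, hk2, hk3, m T, S.pos T, hmin k, hk4,
      fun s _ => hmin _, sd, hsd, -1, by norm_num, ?_, ?_⟩
    · have := fF_le_HF S.contm S.pos (S.pos T).le (hmin k) hk2
      linarith
    · have := fF_le_HF S.contm S.pos (S.pos T).le (hmin k) hk3
      linarith

end Geo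


def wSet (m : ℝ → ℝ) (p q : ℝ × ℝ) : Set ℝ :=
  {L : ℝ | ∃ c : ℝ → ℝ × ℝ, ∃ b : ℝ, 0 ≤ b ∧ ContDiff ℝ 1 c ∧
    c 0 = p ∧ c b = q ∧ L = wLength m c 0 b}

theorem wDist_eq (m : ℝ → ℝ) (p q : ℝ × ℝ) : wDist m p q = sInf (wSet m p q) := rfl

theorem wSet_bdd (m : ℝ → ℝ) (p q : ℝ × ℝ) : BddBelow (wSet m p q) :=
  ⟨0, by rintro _ ⟨c, b, hb, _, _, _, rfl⟩; exact wLength_nonneg m c hb⟩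

theorem wSet_ne (m : ℝ → ℝ) (p q : ℝ × ℝ) : (wSet m p q).Nonempty :=
  ⟨_, fun s => p + s • (q - p), 1, zero_le_one, by fun_prop, by simp, by simp, rfl⟩

theorem wDist_le {m : ℝ → ℝ} {c : ℝ → ℝ × ℝ} (hc : ContDiff ℝ 1 c) {b : ℝ} (hb : 0 ≤ b) :
    wDist m (c 0) (c b) ≤ wLength m c 0 b :=
  csInf_le (wSet_bdd m _ _) ⟨c, b, hb, hc, rfl, rfl, rfl⟩

theorem le_wDist {m : ℝ → ℝ} {p q : ℝ × ℝ} {r : ℝ}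
    (h : ∀ c : ℝ → ℝ × ℝ, ∀ b, 0 ≤ b → ContDiff ℝ 1 c → c 0 = p → c b = q → r ≤ wLength m c 0 b) :
    r ≤ wDist m p q :=
  le_csInf (wSet_ne m p q) (by rintro _ ⟨c, b, h1, h2, h3, h4, rfl⟩; exact h c b h1 h2 h3 h4)

theorem wDist_nonneg (m : ℝ → ℝ) (p q : ℝ × ℝ) : 0 ≤ wDist m p q :=
  le_wDist fun c _ hb _ _ _ => wLength_nonneg m c hb

theorem exists_curve {m : ℝ → ℝ} {p q : ℝ × ℝ} {r : ℝ} (h : wDist m p q < r) :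
    ∃ c : ℝ → ℝ × ℝ, ∃ b, 0 ≤ b ∧ ContDiff ℝ 1 c ∧ c 0 = p ∧ c b = q ∧ wLength m c 0 b < r := by
  obtain ⟨_, ⟨c, b, h1, h2, h3, h4, rfl⟩, hlt⟩ := exists_lt_of_csInf_lt (wSet_ne m p q) h
  exact ⟨c, b, h1, h2, h3, h4, hlt⟩

theorem wLength_congr {m : ℝ → ℝ} {c : ℝ → ℝ × ℝ} {a b : ℝ} {x' y' : ℝ → ℝ}
    (h1 : ∀ s ∈ uIcc a b, HasDerivAt (fun u => (c u).1) (x' s) s)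
    (h2 : ∀ s ∈ uIcc a b, HasDerivAt (fun u => (c u).2) (y' s) s) :
    wLength m c a b = ∫ s in a..b, √((x' s) ^ 2 + (m (c s).1) ^ 2 * (y' s) ^ 2) := by
  unfold wLength
  refine intervalIntegral.integral_congr fun s hs => ?_
  rw [(h1 s hs).deriv, (h2 s hs).deriv]

theorem wLength_reparam {m : ℝ → ℝ} (hm : Continuous m) {c d : ℝ → ℝ × ℝ} (hc : ContDiff ℝ 1 c)
    {f f' : ℝ → ℝ} {a b : ℝ} (hf : ∀ s, HasDerivAt f (f' s) s) (hf' : Continuous f')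
    (hn : ∀ s, 0 ≤ f' s) (hcd : ∀ s ∈ uIcc a b, d s = c (f s))
    (h1 : ∀ s ∈ uIcc a b, HasDerivAt (fun u => (d u).1) (deriv (fun u => (c u).1) (f s) * f' s) s)
    (h2 : ∀ s ∈ uIcc a b, HasDerivAt (fun u => (d u).2) (deriv (fun u => (c u).2) (f s) * f' s) s) :
    wLength m d a b = wLength m c (f a) (f b) := by
  rw [wLength_congr h1 h2]
  unfold wLength
  rw [← intervalIntegral.integral_comp_mul_deriv (fun s _ => hf s) hf'.continuousOn (speed_cont hm hc)]
  refine intervalIntegral.integral_congr fun s hs => ?_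
  simp only [Function.comp]
  rw [hcd s hs, ← Real.sqrt_sq (hn s), ← Real.sqrt_mul (by positivity), Real.sqrt_sq (hn s)]
  congr 1
  ring

theorem st_deriv (s : ℝ) : HasDerivAt Real.smoothTransition (deriv Real.smoothTransition s) s :=
  ((Real.smoothTransition.contDiff (n := 1)).differentiable one_ne_zero s).hasDerivAt

theorem st_deriv_cont : Continuous (deriv Real.smoothTransition) :=
  (Real.smoothTransition.contDiff (n := 1)).continuous_deriv le_rfl

theorem st_deriv_zero {s : ℝ} (h : s ≤ 0 ∨ 1 ≤ s) : deriv Real.smoothTransition s = 0 := by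
  rcases h with h | h
  · have : IsLocalMin Real.smoothTransition s := Filter.Eventually.of_forall fun x => by
      rw [Real.smoothTransition.zero_of_nonpos h]; exact Real.smoothTransition.nonneg x
    exact this.deriv_eq_zero
  · have : IsLocalMax Real.smoothTransition s := Filter.Eventually.of_forall fun x => by
      rw [Real.smoothTransition.one_of_one_le h]; exact Real.smoothTransition.le_one x
    exact this.deriv_eq_zero

theorem st_deriv_nonneg (s : ℝ) : 0 ≤ deriv Real.smoothTransition s :=
  Monotone.deriv_nonneg Real.smoothTransition.monotone

theorem concat {m : ℝ → ℝ} (hm : Continuous m) {c1 c2 : ℝ → ℝ × ℝ} (h1 : ContDiff ℝ 1 c1)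
    (h2 : ContDiff ℝ 1 c2) {b1 b2 : ℝ} (hb1 : 0 ≤ b1) (hb2 : 0 ≤ b2) (h12 : c1 b1 = c2 0) :
    ∃ c : ℝ → ℝ × ℝ, ContDiff ℝ 1 c ∧ c 0 = c1 0 ∧ c 2 = c2 b2 ∧
      wLength m c 0 2 = wLength m c1 0 b1 + wLength m c2 0 b2 := by
  set φ := Real.smoothTransition with hφ
  have hφc : ContDiff ℝ 1 φ := Real.smoothTransition.contDiff
  set f1 : ℝ → ℝ := fun s => b1 * φ s
  set f2 : ℝ → ℝ := fun s => b2 * φ (s - 1)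
  have d1 : ∀ s, HasDerivAt f1 (b1 * deriv φ s) s := fun s => (st_deriv s).const_mul b1
  have d2 : ∀ s, HasDerivAt f2 (b2 * deriv φ (s - 1)) s := fun s =>
    ((st_deriv (s - 1)).comp_sub_const s 1).const_mul b2
  have z1 : ∀ s, 1 ≤ s → φ s = 1 := fun s => Real.smoothTransition.one_of_one_le
  have z2 : ∀ s, s ≤ 0 → φ s = 0 := fun s => Real.smoothTransition.zero_of_nonpos
  set c : ℝ → ℝ × ℝ := fun s => c1 (f1 s) + c2 (f2 s) - c2 0 with hcdef
  have hf1 : ContDiff ℝ 1 f1 := contDiff_const.mul hφc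
  have hf2 : ContDiff ℝ 1 f2 := contDiff_const.mul (hφc.comp (contDiff_id.sub contDiff_const))
  have hc : ContDiff ℝ 1 c := ((h1.comp hf1).add (h2.comp hf2)).sub contDiff_const
  have e1 : ∀ s, HasDerivAt (fun u => (c u).1)
      (deriv (fun u => (c1 u).1) (f1 s) * (b1 * deriv φ s) +
       deriv (fun u => (c2 u).1) (f2 s) * (b2 * deriv φ (s - 1))) s := fun s =>
    ((HasDerivAt.comp s (h₂ := fun u => (c1 u).1) (curve_hd1 h1 _) (d1 s)).add
      (HasDerivAt.comp s (h₂ := fun u => (c2 u).1) (curve_hd1 h2 _) (d2 s))).sub_const _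
  have e2 : ∀ s, HasDerivAt (fun u => (c u).2)
      (deriv (fun u => (c1 u).2) (f1 s) * (b1 * deriv φ s) +
       deriv (fun u => (c2 u).2) (f2 s) * (b2 * deriv φ (s - 1))) s := fun s =>
    ((HasDerivAt.comp s (h₂ := fun u => (c1 u).2) (curve_hd2 h1 _) (d1 s)).add
      (HasDerivAt.comp s (h₂ := fun u => (c2 u).2) (curve_hd2 h2 _) (d2 s))).sub_const _
  refine ⟨c, hc, ?_, ?_, ?_⟩
  · simp [hcdef, f1, f2, z2]
  · simp only [hcdef, f1, f2, z1 2 one_le_two, z1 (2 - 1) (by norm_num), mul_one, h12]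
    simp
  · rw [← wLength_add hm hc 0 1 2]
    have g1 : wLength m c 0 1 = wLength m c1 (f1 0) (f1 1) := by
      refine wLength_reparam hm h1 d1 (continuous_const.mul st_deriv_cont)
        (fun s => mul_nonneg hb1 (st_deriv_nonneg s)) ?_ ?_ ?_ <;> intro s hs <;>
        rw [uIcc_of_le zero_le_one] at hs
      · simp [hcdef, f2, z2 (s - 1) (by linarith [hs.2])]
      · refine hd_cast (e1 s) (fun _ => rfl) ?_
        rw [hφ, st_deriv_zero (s := s - 1) (Or.inl (by linarith [hs.2]))]; ring
      · refine hd_cast (e2 s) (fun _ => rfl) ?_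
        rw [hφ, st_deriv_zero (s := s - 1) (Or.inl (by linarith [hs.2]))]; ring
    have g2 : wLength m c 1 2 = wLength m c2 (f2 1) (f2 2) := by
      refine wLength_reparam hm h2 d2
        (continuous_const.mul (st_deriv_cont.comp (continuous_id.sub continuous_const)))
        (fun s => mul_nonneg hb2 (st_deriv_nonneg _)) ?_ ?_ ?_ <;> intro s hs <;>
        rw [uIcc_of_le one_le_two] at hs
      · simp [hcdef, f1, z1 s hs.1, h12]
      · refine hd_cast (e1 s) (fun _ => rfl) ?_
        rw [hφ, st_deriv_zero (s := s) (Or.inr hs.1)]; ring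
      · refine hd_cast (e2 s) (fun _ => rfl) ?_
        rw [hφ, st_deriv_zero (s := s) (Or.inr hs.1)]; ring
    rw [g1, g2]
    simp only [f1, f2, z2 0 le_rfl, z1 1 le_rfl, z2 (1 - 1) (by norm_num), z1 (2 - 1) (by norm_num),
      mul_zero, mul_one]

theorem wDist_triangle {m : ℝ → ℝ} (hm : Continuous m) (p q r : ℝ × ℝ) :
    wDist m p r ≤ wDist m p q + wDist m q r := by
  refine le_of_forall_pos_le_add fun ε hε => ?_
  obtain ⟨c1, b1, hb1, h1, h10, h1b, hl1⟩ :=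
    exists_curve (m := m) (p := p) (q := q) (r := wDist m p q + ε / 2) (by linarith)
  obtain ⟨c2, b2, hb2, h2, h20, h2b, hl2⟩ :=
    exists_curve (m := m) (p := q) (q := r) (r := wDist m q r + ε / 2) (by linarith)
  obtain ⟨c, hc, hc0, hc2, hl⟩ := concat hm h1 h2 hb1 hb2 (by rw [h1b, h20])
  have := wDist_le (m := m) hc (b := 2) (by norm_num)
  rw [hc0, hc2, h10, h2b, hl] at this
  linarith

theorem wDist_negt_le {m : ℝ → ℝ} (he : ∀ x, m (-x) = m x) (x y α β : ℝ) :
    wDist m (-x, α) (-y, β) ≤ wDist m (x, α) (y, β) := by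
  refine le_wDist fun c b hb hc h0 h1 => ?_
  have := wDist_le (m := m) (Rf_contDiff hc) hb
  rw [Rf_wLength he] at this
  simpa [Rf, h0, h1] using this

theorem wDist_negt {m : ℝ → ℝ} (he : ∀ x, m (-x) = m x) (x y α β : ℝ) :
    wDist m (-x, α) (-y, β) = wDist m (x, α) (y, β) := by
  apply le_antisymm (wDist_negt_le he x y α β)
  have := wDist_negt_le he (-x) (-y) α β
  simpa using this

theorem wDist_scale {m : ℝ → ℝ} (hm : Continuous m) {x y α β α' β' : ℝ}
    (h : |β - α| ≤ |β' - α'|) : wDist m (x, α) (y, β) ≤ wDist m (x, α') (y, β') := by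
  refine le_wDist fun c b hb hc h0 h1 => ?_
  set l : ℝ := (β - α) / (β' - α') with hl
  have hl1 : l ^ 2 ≤ 1 := by
    rw [hl, div_pow]
    exact div_le_one_of_le₀ (sq_le_sq.2 h) (sq_nonneg _)
  have hl2 : l * (β' - α') = β - α := by
    by_cases hz : β' - α' = 0
    · rw [hz, abs_zero] at h
      rw [hz, mul_zero]; exact (abs_nonpos_iff.1 h).symm
    · rw [hl]; field_simp
  set d : ℝ → ℝ × ℝ := fun s => ((c s).1, α + l * ((c s).2 - α')) with hd
  have hdc : ContDiff ℝ 1 d :=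
    hc.fst.prodMk (contDiff_const.add (contDiff_const.mul (hc.snd.sub contDiff_const)))
  have e2 : ∀ s, HasDerivAt (fun u => (d u).2) (l * deriv (fun u => (c u).2) s) s := fun s =>
    (((curve_hd2 hc s).sub_const α').const_mul l).const_add α
  have hlen : wLength m d 0 b ≤ wLength m c 0 b := by
    apply intervalIntegral.integral_mono_on hb ((speed_cont hm hdc).intervalIntegrable _ _)
      ((speed_cont hm hc).intervalIntegrable _ _)
    intro s _
    apply Real.sqrt_le_sqrt
    rw [(e2 s).deriv, mul_pow]
    have : l ^ 2 * deriv (fun u => (c u).2) s ^ 2 ≤ deriv (fun u => (c u).2) s ^ 2 := by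
      nlinarith [sq_nonneg (deriv (fun u => (c u).2) s)]
    have h4 := mul_le_mul_of_nonneg_left this (sq_nonneg (m (c s).1))
    simpa [hd] using h4
  have h3 := wDist_le (m := m) hdc hb
  have a0 : d 0 = (x, α) := by simp [hd, h0]
  have ab : d b = (y, β) := by
    simp only [hd, h1]
    rw [hl2]; simp
  rw [a0, ab] at h3
  exact h3.trans hlen

theorem wDist_horiz {m : ℝ → ℝ} (hp : ∀ x, 0 < m x) (h α β : ℝ) :
    wDist m (h, α) (h, β) ≤ m h * |β - α| := by
  set d : ℝ → ℝ × ℝ := fun s => (h, α + s * (β - α)) with hd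
  have hdc : ContDiff ℝ 1 d := by fun_prop
  have h3 := wDist_le (m := m) hdc zero_le_one
  have e : wLength m d 0 1 = m h * |β - α| := by
    rw [wLength_congr (x' := fun _ => 0) (y' := fun _ => β - α) (fun s _ => hasDerivAt_const s h)
      (fun s _ => hd_cast (((hasDerivAt_id s).mul_const (β - α)).const_add α) (fun _ => rfl) (by simp))]
    have : ∀ s, √(0 ^ 2 + m (d s).1 ^ 2 * (β - α) ^ 2) = m h * |β - α| := by
      intro s
      simp only [hd]
      rw [← sq_abs (β - α), zero_pow two_ne_zero, zero_add, ← mul_pow, Real.sqrt_sq]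
      have := hp h
      positivity
    simp only [this]
    simp
  rw [e] at h3
  simpa [hd] using h3

namespace Geo
variable {m m1 m2 : ℝ → ℝ} {ν : ℝ} {t t' θ : ℝ → ℝ}

theorem contDiff (S : Setup m m1 m2) (G : Geo m m1 ν t t' θ) : ContDiff ℝ 1 fun s => (t s, θ s) := by
  have h1 : ContDiff ℝ 1 t := by
    rw [contDiff_one_iff_deriv]
    refine ⟨fun s => (G.dt s).differentiableAt, ?_⟩
    rw [show deriv t = t' from funext fun s => (G.dt s).deriv]; exact G.contt'
  have h2 : ContDiff ℝ 1 θ := by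
    rw [contDiff_one_iff_deriv]
    refine ⟨fun s => (G.dθ s).differentiableAt, ?_⟩
    rw [show deriv θ = fun s => ν / m (t s) ^ 2 from funext fun s => (G.dθ s).deriv]
    exact continuous_const.div ((S.contm.comp G.contt).pow 2) fun s => pow_ne_zero 2 (S.pos _).ne'
  exact h1.prodMk h2

theorem wDist_le (S : Setup m m1 m2) (G : Geo m m1 ν t t' θ) {a b : ℝ} (h : a ≤ b) :
    wDist m (t a, θ a) (t b, θ b) ≤ b - a := by
  have G' := G.shift a
  have h1 := _root_.wDist_le (m := m) (G'.contDiff S) (sub_nonneg.2 h)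
  simp only [zero_add, sub_add_cancel] at h1
  refine h1.trans (le_of_eq ?_)
  rw [wLength_congr (fun s _ => G'.dt s) (fun s _ => G'.dθ s)]
  have : ∀ s, √(t' (s + a) ^ 2 + m (t (s + a)) ^ 2 * (ν / m (t (s + a)) ^ 2) ^ 2) = 1 := by
    intro s
    rw [Real.sqrt_eq_one, ← G.en (s + a)]
    have := S.pos (t (s + a))
    field_simp
  simp [this]

theorem thmA (S : Setup m m1 m2) (G : Geo m m1 ν t t' θ) {b : ℝ} (hb : 0 ≤ b)
    (hneg : ∀ s ∈ Icc 0 b, t s < 0) : wDist m (t 0, θ 0) (t b, θ b) = b := by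
  have key : ∀ {ν : ℝ} {θ : ℝ → ℝ}, Geo m m1 ν t t' θ → 0 ≤ ν →
      b ≤ wDist m (t 0, θ 0) (t b, θ b) := fun G hν =>
    le_wDist fun c B hB hc h0 h1 => G.thmA_pos S hν hb hneg hc hB h0 h1
  apply le_antisymm
  · simpa using G.wDist_le S hb
  rcases le_total 0 ν with h | h
  · exact key G h
  · refine (key G.negθ (by linarith)).trans (wDist_scale S.contm (le_of_eq ?_))
    rw [← abs_neg]; congr 1; ring

theorem thmA' (S : Setup m m1 m2) (G : Geo m m1 ν t t' θ) {b : ℝ} (hb : 0 < b)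
    (hneg : ∀ s ∈ Ioc 0 b, t s < 0) : wDist m (t 0, θ 0) (t b, θ b) = b := by
  apply le_antisymm
  · simpa using G.wDist_le S hb.le
  refine le_of_forall_pos_le_add fun ε hε => ?_
  set δ := min (ε / 2) b with hδ
  have hδ0 : 0 < δ := lt_min (by linarith) hb
  have hδb : δ ≤ b := min_le_right _ _
  have h1 := (G.shift δ).thmA S (b := b - δ) (by linarith) (fun s hs =>
    hneg _ ⟨by linarith [hs.1], by linarith [hs.2]⟩)
  simp only [zero_add, sub_add_cancel] at h1
  have h2 := wDist_triangle S.contm (t δ, θ δ) (t 0, θ 0) (t b, θ b)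
  have h3 := G.wDist_le S hδ0.le
  have h4 : wDist m (t δ, θ δ) (t 0, θ 0) ≤ δ := by
    have := (G.rev δ).wDist_le S hδ0.le
    simp only [sub_zero, sub_self] at this
    refine le_trans (wDist_scale S.contm (le_of_eq ?_)) this
    rw [← abs_neg]; congr 1; ring
  have : δ ≤ ε / 2 := min_le_left _ _
  linarith

end Geo


namespace Geo
variable {m m1 m2 : ℝ → ℝ} {ν : ℝ} {t t' θ : ℝ → ℝ}

theorem theta_lip (S : Setup m m1 m2) (G : Geo m m1 ν t t' θ) {a b κ : ℝ} (hab : a ≤ b)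
    (h : ∀ s ∈ Ioo a b, |ν| / m (t s) ^ 2 ≤ κ) : |θ b - θ a| ≤ κ * (b - a) := by
  have hb : ∀ s ∈ Ioo a b, |ν / m (t s) ^ 2| ≤ κ := fun s hs => by
    rw [abs_div, abs_of_pos (pow_pos (S.pos (t s)) 2)]; exact h s hs
  have h1 := le_of_hasDerivAt_nonneg (f := fun s => κ * s - θ s) hab
    ((continuous_const.mul continuous_id).sub G.contθ).continuousOn
    (fun s _ => ((hasDerivAt_id s).const_mul κ).sub (G.dθ s))
    (fun s hs => by have := le_abs_self (ν / m (t s) ^ 2); linarith [hb s hs])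
  have h2 := le_of_hasDerivAt_nonneg (f := fun s => κ * s + θ s) hab
    ((continuous_const.mul continuous_id).add G.contθ).continuousOn
    (fun s _ => ((hasDerivAt_id s).const_mul κ).add (G.dθ s))
    (fun s hs => by have := neg_abs_le (ν / m (t s) ^ 2); linarith [hb s hs])
  rw [abs_le]
  constructor <;> linarith

theorem no_cross (S : Setup m m1 m2) (G : Geo m m1 ν t t' θ) {a : ℝ} (ha : 0 < a)
    (h0 : t 0 ≤ 0) (hta : t a < 0) (hmin : wDist m (t 0, θ 0) (t a, θ a) = a) :
    ∀ s ∈ Ioc 0 a, t s < 0 := by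
  by_contra hcon
  push Not at hcon
  obtain ⟨s', hs', hts'⟩ := hcon
  have hZc : IsCompact (Icc 0 a ∩ {s | 0 ≤ t s}) :=
    isCompact_Icc.inter_right (isClosed_le continuous_const G.contt)
  obtain ⟨s1, ⟨hs1, hts1⟩, hgr⟩ := hZc.exists_isGreatest ⟨s', ⟨hs'.1.le, hs'.2⟩, hts'⟩
  have hs1pos : 0 < s1 := hs'.1.trans_le (hgr ⟨⟨hs'.1.le, hs'.2⟩, hts'⟩)
  have hafter : ∀ s, s1 < s → s ≤ a → t s < 0 := by
    intro s h1 h2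
    by_contra h
    push Not at h
    exact absurd (hgr ⟨⟨by linarith, h2⟩, h⟩) (not_le.2 h1)
  have hs1a : s1 < a := lt_of_le_of_ne hs1.2 fun h => by
    rw [h] at hts1; exact absurd hta (not_lt.2 hts1)
  have hts0 : t s1 = 0 := by
    apply le_antisymm _ hts1
    have hcl : s1 ∈ closure (Ioo s1 a) := by
      rw [closure_Ioo hs1a.ne]; exact ⟨le_rfl, hs1a.le⟩
    exact closure_minimal (s := Ioo s1 a) (t := {x | t x ≤ 0})
      (fun x hx => (hafter x hx.1 hx.2.le).le) (isClosed_le G.contt continuous_const) hcl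
  have hne : t' s1 ≠ 0 := by
    intro h
    have := G.const_of_eq S h (by rw [hts0]; exact S.m1_zero) a
    rw [hts0] at this
    linarith
  have hp0 := S.pos 0
  have hν : |ν| / m 0 < 1 := by
    have h1 := G.en s1
    rw [hts0] at h1
    have h2 : 0 < t' s1 ^ 2 := by positivity
    rw [div_lt_one hp0]
    have h3 : ν ^ 2 / m 0 ^ 2 < 1 := by linarith
    rw [div_lt_one (by positivity)] at h3
    exact abs_lt_of_sq_lt_sq h3 hp0.le
  have hneg' : t' s1 < 0 := by
    rcases lt_or_gt_of_ne hne with h | h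
    · exact h
    exfalso
    have hev : ∀ᶠ s in nhds s1, 0 < t' s := G.contt'.continuousAt.eventually (lt_mem_nhds h)
    obtain ⟨δ, hδ, hd⟩ := Metric.eventually_nhds_iff.1 hev
    set v := s1 + min δ (a - s1) / 2 with hv
    have hmn : 0 < min δ (a - s1) := lt_min hδ (by linarith)
    have l1 := min_le_left δ (a - s1)
    have l2 := min_le_right δ (a - s1)
    have := lt_of_hasDerivAt_pos (a := s1) (b := v) (by linarith) G.contt.continuousOn
      (fun s _ => G.dt s) (fun s hs => hd (by
        rw [Real.dist_eq, abs_of_pos (by linarith [hs.1])]; linarith [hs.2]))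
    linarith [hafter v (by linarith) (by linarith)]
  -- choose κ
  obtain ⟨κ, hκ1, hκ2⟩ : ∃ κ, |ν| / m 0 ^ 2 < κ ∧ κ < 1 / m 0 := exists_between (by
    rw [sq, ← div_div]; gcongr)
  have ev1 : ∀ᶠ s in nhds s1, t' s < 0 := G.contt'.continuousAt.eventually (gt_mem_nhds hneg')
  have ev2 : ∀ᶠ s in nhds s1, |ν| / m (t s) ^ 2 < κ := by
    have hc : Continuous fun s => |ν| / m (t s) ^ 2 :=
      continuous_const.div ((S.contm.comp G.contt).pow 2) fun s => pow_ne_zero 2 (S.pos _).ne'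
    exact hc.continuousAt.eventually (gt_mem_nhds (by simpa [hts0] using hκ1))
  have ev3 : ∀ᶠ h in nhds (0:ℝ), m h * κ < 1 := by
    have hc : Continuous fun h => m h * κ := S.contm.mul continuous_const
    refine hc.continuousAt.eventually (gt_mem_nhds ?_)
    rw [lt_div_iff₀ hp0] at hκ2
    linarith
  obtain ⟨δ, hδ, hd⟩ := Metric.eventually_nhds_iff.1 (ev1.and ev2)
  obtain ⟨η, hη, hdη⟩ := Metric.eventually_nhds_iff.1 ev3
  set u := s1 - min δ s1 / 2 with hu
  set v := s1 + min δ (a - s1) / 2 with hv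
  have hm1 : 0 < min δ s1 := lt_min hδ hs1pos
  have hm2 : 0 < min δ (a - s1) := lt_min hδ (by linarith)
  have l1 := min_le_left δ (a - s1)
  have l2 := min_le_right δ (a - s1)
  have l3 := min_le_left δ s1
  have l4 := min_le_right δ s1
  have hd' : ∀ s ∈ Icc u v, t' s < 0 ∧ |ν| / m (t s) ^ 2 < κ := fun s hs => hd (by
    rw [Real.dist_eq, abs_lt]; constructor <;> linarith [hs.1, hs.2])
  have htu : 0 < t u := by
    have := lt_of_hasDerivAt_pos (f := fun s => - t s) (a := u) (b := s1) (by linarith)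
      G.contt.neg.continuousOn (fun s _ => (G.dt s).neg) (fun s hs => by
        have := (hd' s ⟨hs.1.le, by linarith [hs.2]⟩).1
        linarith)
    linarith
  have htv : t v < 0 := hafter v (by linarith) (by linarith)
  set h := min (min (t u) (- t v)) (η / 2) with hh
  have hhpos : 0 < h := lt_min (lt_min htu (by linarith)) (by linarith)
  have hh1 : h ≤ t u := (min_le_left _ _).trans (min_le_left _ _)
  have hh2 : h ≤ - t v := (min_le_left _ _).trans (min_le_right _ _)
  have hh3 : h ≤ η / 2 := min_le_right _ _
  obtain ⟨sm, hsm, htm⟩ := intermediate_value_Icc' (a := u) (b := s1) (by linarith)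
    G.contt.continuousOn (show h ∈ Icc (t s1) (t u) from ⟨by linarith, hh1⟩)
  obtain ⟨sp, hsp, htp⟩ := intermediate_value_Icc' (a := s1) (b := v) (by linarith)
    G.contt.continuousOn (show -h ∈ Icc (t v) (t s1) from ⟨by linarith, by linarith⟩)
  obtain ⟨s0, hs0, ht0⟩ := intermediate_value_Icc (a := 0) (b := sm) (by linarith [hsm.1])
    G.contt.continuousOn (show 0 ∈ Icc (t 0) (t sm) from ⟨h0, by linarith⟩)
  have hmp : sm < sp := by
    rcases lt_or_ge sm sp with h' | h'
    · exact h'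
    · have : sm = sp := le_antisymm (by linarith [hsm.2, hsp.1]) h'
      rw [this] at htm; linarith
  have hlip := G.theta_lip S hmp.le (fun s hs =>
    (hd' s ⟨by linarith [hs.1, hsm.1], by linarith [hs.2, hsp.2]⟩).2.le)
  have D1 := G.wDist_le S hs0.1
  have D2 : wDist m (t s0, θ s0) (-h, θ sm) ≤ sm - s0 := by
    have := G.wDist_le S hs0.2
    rw [← wDist_negt S.even, htm, ht0, neg_zero] at this
    rwa [ht0]
  have D3 := wDist_horiz S.pos (-h) (θ sm) (θ sp)
  have D4 := G.wDist_le S (a := sp) (b := a) (by linarith [hsp.2])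
  rw [htp] at D4
  have T1 := wDist_triangle S.contm (t 0, θ 0) (t s0, θ s0) (t a, θ a)
  have T2 := wDist_triangle S.contm (t s0, θ s0) (-h, θ sm) (t a, θ a)
  have T3 := wDist_triangle S.contm (-h, θ sm) (-h, θ sp) (t a, θ a)
  have hmκ : m h * κ < 1 := hdη (by rw [Real.dist_eq, sub_zero, abs_of_pos hhpos]; linarith)
  rw [S.even] at D3
  have D5 : m h * |θ sp - θ sm| < sp - sm := by
    have e1 := mul_le_mul_of_nonneg_left hlip (S.pos h).le
    have e2 := mul_lt_mul_of_pos_right hmκ (sub_pos.2 hmp)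
    linarith
  linarith

theorem extend_neg (S : Setup m m1 m2) (G : Geo m m1 ν t t' θ) {a : ℝ} (ha : 0 < a)
    (h0 : t 0 ≤ 0) (hta : t a < 0) (hmin : wDist m (t 0, θ 0) (t a, θ a) = a) :
    ∃ δ > 0, ∀ ε, 0 < ε → ε ≤ δ → wDist m (t 0, θ 0) (t (a + ε), θ (a + ε)) = a + ε := by
  have h1 := G.no_cross S ha h0 hta hmin
  have ev : ∀ᶠ s in nhds a, t s < 0 := G.contt.continuousAt.eventually (gt_mem_nhds hta)
  obtain ⟨δ, hδ, hd⟩ := Metric.eventually_nhds_iff.1 ev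
  refine ⟨δ / 2, by linarith, fun ε hε hεδ => G.thmA' S (by linarith) fun s hs => ?_⟩
  rcases le_or_gt s a with h | h
  · exact h1 s ⟨hs.1, h⟩
  · exact hd (by rw [Real.dist_eq, abs_of_pos (by linarith)]; linarith [hs.2])

theorem extend_ne (S : Setup m m1 m2) (G : Geo m m1 ν t t' θ) {a : ℝ} (ha : 0 < a)
    (h0 : t 0 = 0) (hta : t a ≠ 0) (hmin : wDist m (t 0, θ 0) (t a, θ a) = a) :
    ∃ δ > 0, ∀ ε, 0 < ε → ε ≤ δ → wDist m (t 0, θ 0) (t (a + ε), θ (a + ε)) = a + ε := by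
  rcases lt_or_gt_of_ne hta with h | h
  · exact G.extend_neg S ha h0.le h hmin
  · have := (G.negt S).extend_neg S ha (by simp [h0]) (by linarith) (by rwa [wDist_negt S.even])
    simpa only [wDist_negt S.even] using this

theorem strict_scale (S : Setup m m1 m2) (G : Geo m m1 ν t t' θ) {a r : ℝ} (ha : 0 < a)
    (hr : |r| < |θ a - θ 0|) : wDist m (t 0, θ 0) (t a, θ 0 + r) < a := by
  have hD : θ a - θ 0 ≠ 0 := fun h => by
    rw [h, abs_zero] at hr; exact absurd hr (not_lt.2 (abs_nonneg r))
  have hν : ν ≠ 0 := by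
    intro h
    apply hD
    have := eq_of_hasDerivAt_zero ha.le G.contθ.continuousOn
      (fun s _ => hd_cast (G.dθ s) (fun _ => rfl) (by rw [h, zero_div]))
    rw [this, sub_self]
  set l := r / (θ a - θ 0) with hl
  have hl1 : l ^ 2 < 1 := by
    rw [hl, div_pow, div_lt_one (by positivity)]
    exact sq_lt_sq.2 hr
  have hl2 : l * (θ a - θ 0) = r := by rw [hl]; field_simp
  set d : ℝ → ℝ × ℝ := fun s => (t s, θ 0 + l * (θ s - θ 0)) with hd
  have hG := G.contDiff S
  have hdc : ContDiff ℝ 1 d :=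
    hG.fst.prodMk (contDiff_const.add (contDiff_const.mul (hG.snd.sub contDiff_const)))
  have e2 : ∀ s, HasDerivAt (fun u => (d u).2) (l * (ν / m (t s) ^ 2)) s := fun s =>
    (((G.dθ s).sub_const (θ 0)).const_mul l).const_add (θ 0)
  have e1 : ∀ s, HasDerivAt (fun u => (d u).1) (t' s) s := G.dt
  have hlt : ∀ s, √(deriv (fun u => (d u).1) s ^ 2 + m (d s).1 ^ 2 * deriv (fun u => (d u).2) s ^ 2)
      < 1 := by
    intro s
    rw [Real.sqrt_lt' one_pos, (e1 s).deriv, (e2 s).deriv, one_pow, ← G.en s]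
    have hp := S.pos (t s)
    have e : m (d s).1 ^ 2 * (l * (ν / m (t s) ^ 2)) ^ 2 = l ^ 2 * (ν ^ 2 / m (t s) ^ 2) := by
      simp only [hd]; field_simp
    rw [e]
    have : 0 < ν ^ 2 / m (t s) ^ 2 := by positivity
    nlinarith
  have hlen : wLength m d 0 a < a := by
    have := intervalIntegral.integral_lt_integral_of_continuousOn_of_le_of_exists_lt ha
      (speed_cont S.contm hdc).continuousOn (continuousOn_const (c := (1:ℝ)))
      (fun s _ => (hlt s).le) ⟨0, ⟨le_rfl, ha.le⟩, hlt 0⟩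
    simpa [wLength] using this
  have h3 := _root_.wDist_le (m := m) hdc ha.le
  have a0 : d 0 = (t 0, θ 0) := by simp [hd]
  have ab : d a = (t a, θ 0 + r) := by simp only [hd]; rw [hl2]
  rw [a0, ab] at h3
  linarith

end Geo

theorem geoOf {m : ℝ → ℝ} (hp : ∀ x, 0 < m x) {γ : ℝ → ℝ × ℝ} (h : IsUnitGeodesic m γ) :
    ∃ ν, Geo m (deriv m) ν (fun s => (γ s).1) (deriv fun s => (γ s).1) (fun s => (γ s).2) := by
  obtain ⟨hc, h2, ⟨ν, hν⟩, hen⟩ := h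
  have hθ : ∀ s, deriv (fun u => (γ u).2) s = ν / m (γ s).1 ^ 2 := fun s => by
    have := hp (γ s).1
    rw [← hν s]; field_simp
  have hc1 : ContDiff ℝ 1 γ := hc.of_le (by norm_num)
  have hd2 : ∀ s, DifferentiableAt ℝ (deriv fun s => (γ s).1) s := by
    have h3 : ContDiff ℝ (1 + 1) (fun s => (γ s).1) := by
      have := hc.fst; rwa [one_add_one_eq_two]
    exact (contDiff_succ_iff_deriv.1 h3).2.2.differentiable one_ne_zero
  refine ⟨ν, curve_hd1 hc1, fun s => ?_, fun s => ?_, fun s => ?_⟩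
  · refine hd_cast (hd2 s).hasDerivAt (fun _ => rfl) ?_
    rw [h2, hθ]
    have := hp (γ s).1
    field_simp
  · rw [← hθ]; exact curve_hd2 hc1 s
  · rw [← hen s, hθ]
    have := hp (γ s).1
    field_simp

theorem setupOf {m : ℝ → ℝ} (hm : ContDiff ℝ (⊤:ℕ∞) m) (hmpos : ∀ t, 0 < m t)
    (hmeven : ∀ t, m (-t) = m t)
    (hK0 : 0 < gaussK m 0) (hKdec : AntitoneOn (gaussK m) (Ici 0)) :
    Setup m (deriv m) (deriv (deriv m)) := by
  have h1 : ContDiff ℝ (1 + 1) m := by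
    rw [one_add_one_eq_two]; exact contDiff_infty.1 hm 2
  have h2 : ContDiff ℝ 1 (deriv m) := (contDiff_succ_iff_deriv.1 h1).2.2
  have hodd : ∀ x, deriv m (-x) = - deriv m x := fun x => by
    have h3 : (fun y => m (-y)) = m := funext hmeven
    have := deriv_comp_neg m x
    rw [h3] at this
    linarith
  refine ⟨fun x => (h1.differentiable (by norm_num) x).hasDerivAt,
    fun x => (h2.differentiable one_ne_zero x).hasDerivAt, h2.continuous_deriv le_rfl, hmpos, hmeven,
    hodd, fun x => ?_, fun x y hx hxy => ?_, ?_⟩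
  · have h3 : (fun y => deriv m (-y)) = fun y => - deriv m y := funext hodd
    have := deriv_comp_neg (deriv m) x
    rw [h3, deriv.fun_neg] at this
    linarith
  · have := hKdec (mem_Ici.2 hx) (mem_Ici.2 (hx.trans hxy)) hxy
    simp only [gaussK, neg_div] at this
    linarith
  · simp only [gaussK] at hK0
    have := (div_pos_iff_of_pos_right (hmpos 0)).1 hK0
    linarith

theorem angle_min {x y : ℝ} (h : (x : Real.Angle) = (y : Real.Angle)) (hy : |y| ≤ π) : |y| ≤ |x| := by
  obtain ⟨k, hk⟩ := Real.Angle.angle_eq_iff_two_pi_dvd_sub.1 h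
  rcases eq_or_ne k 0 with rfl | hk0
  · have : x = y := by simpa [sub_eq_zero] using hk
    rw [this]
  · have h1 : (1:ℝ) ≤ |(k:ℝ)| := by exact_mod_cast Int.one_le_abs hk0
    have h2 : |x - y| = 2 * π * |(k:ℝ)| := by
      rw [hk, abs_mul, abs_of_pos (by positivity)]
    have h3 := abs_sub x y
    have := Real.pi_pos
    nlinarith

theorem cylDist_le (m : ℝ → ℝ) {p q : ℝ × ℝ} {P Q : ℝ × Real.Angle} (hp : proj p = P)
    (hq : proj q = Q) : cylDist m P Q ≤ wDist m p q :=
  csInf_le ⟨0, by rintro _ ⟨p, q, _, _, rfl⟩; exact wDist_nonneg m p q⟩ ⟨p, q, hp, hq, rfl⟩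

theorem cylDist_eq {m : ℝ → ℝ} (hm : Continuous m) {p q : ℝ × ℝ} (h : |q.2 - p.2| ≤ π) :
    cylDist m (proj p) (proj q) = wDist m p q := by
  apply le_antisymm (cylDist_le m rfl rfl)
  refine le_csInf ⟨_, p, q, rfl, rfl, rfl⟩ ?_
  rintro _ ⟨p', q', hp, hq, rfl⟩
  obtain ⟨x, α⟩ := p
  obtain ⟨y, β⟩ := q
  obtain ⟨x', α'⟩ := p'
  obtain ⟨y', β'⟩ := q'
  simp only [proj, Prod.mk.injEq] at hp hq
  obtain ⟨rfl, hα⟩ := hp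
  obtain ⟨rfl, hβ⟩ := hq
  apply wDist_scale hm
  apply angle_min _ h
  simp only [Real.Angle.coe_sub, hα, hβ]


theorem part12 {m : ℝ → ℝ} (S : Setup m (deriv m) (deriv (deriv m))) {p x : ℝ × ℝ}
    (hp : p.1 ≤ 0) (hx : x ∈ cutLocus m p) : ¬ x.1 < 0 := by
  intro hx0
  obtain ⟨γ, a, hγ, h0, ha, hax, hmin, hcut⟩ := hx
  obtain ⟨ν, G⟩ := geoOf S.pos hγ
  obtain ⟨δ, hδ, h⟩ := Geo.extend_neg S G ha (by simpa [h0] using hp) (by simpa [hax] using hx0) hmin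
  exact hcut δ hδ (h δ hδ le_rfl)

theorem part2 {m : ℝ → ℝ} (S : Setup m (deriv m) (deriv (deriv m))) {p x : ℝ × ℝ}
    (hp : p.1 = 0) (hx : x ∈ cutLocus m p) : x.1 = 0 := by
  by_contra hx0
  obtain ⟨γ, a, hγ, h0, ha, hax, hmin, hcut⟩ := hx
  obtain ⟨ν, G⟩ := geoOf S.pos hγ
  obtain ⟨δ, hδ, h⟩ := Geo.extend_ne S G ha (by simpa [h0] using hp) (by simpa [hax] using hx0) hmin
  exact hcut δ hδ (h δ hδ le_rfl)

theorem part3 {m : ℝ → ℝ} (S : Setup m (deriv m) (deriv (deriv m))) {P X : ℝ × Real.Angle}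
    (hP : P = (0, ((0:ℝ) : Real.Angle))) (hx : X ∈ cylCutLocus m P) :
    X.2 = ((π:ℝ) : Real.Angle) ∨ X.1 = 0 := by
  obtain ⟨γ, a, ⟨c, hc, rfl⟩, h0, ha, hax, hmin, hcut⟩ := hx
  obtain ⟨ν, G⟩ := geoOf S.pos hc
  have hmin' : cylDist m (proj (c 0)) (proj (c a)) = a := hmin
  have hP1 : (c 0).1 = 0 := by
    have := congrArg Prod.fst h0; rw [hP] at this; simpa [proj] using this
  have hP2 : (((c 0).2 : ℝ) : Real.Angle) = 0 := by
    have := congrArg Prod.snd h0; rw [hP] at this; simpa [proj] using this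
  have hw : wDist m (c 0) (c a) = a := by
    have h1 : cylDist m (proj (c 0)) (proj (c a)) ≤ wDist m (c 0) (c a) := cylDist_le m rfl rfl
    have h2 : wDist m (c 0) (c a) ≤ a - 0 := Geo.wDist_le S G ha.le
    linarith
  have hle : |(c a).2 - (c 0).2| ≤ π := by
    by_contra hcon
    push Not at hcon
    set r := (((c a).2 - (c 0).2 : ℝ) : Real.Angle).toReal with hr
    have hr1 : |r| ≤ π := Real.Angle.abs_toReal_le_pi _
    have h1 : wDist m (c 0) ((c a).1, (c 0).2 + r) < a :=
      Geo.strict_scale S G ha (lt_of_le_of_lt hr1 hcon)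
    have h2 : cylDist m (proj (c 0)) (proj (c a)) ≤ wDist m (c 0) ((c a).1, (c 0).2 + r) := by
      refine cylDist_le m rfl ?_
      simp only [proj, Real.Angle.coe_add, hr, Real.Angle.coe_toReal, Real.Angle.coe_sub]
      congr 1
      abel
    linarith
  have hX : X = proj (c a) := hax.symm
  rcases hle.lt_or_eq with hlt | heq
  · right
    by_contra hx0
    obtain ⟨δ, hδ, h⟩ := Geo.extend_ne S G ha hP1 (by rw [hX] at hx0; exact hx0) hw
    have hcont : Continuous fun s => |(c s).2 - (c 0).2| :=
      (G.contθ.sub continuous_const).abs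
    have hev := (hcont.continuousAt (x := a)).eventually_lt continuousAt_const hlt
    obtain ⟨η, hη, hη'⟩ := Metric.eventually_nhds_iff.1 hev
    have hε : 0 < min δ (η / 2) := lt_min hδ (by positivity)
    refine hcut _ hε ?_
    show cylDist m (proj (c 0)) (proj (c (a + min δ (η/2)))) = _
    rw [cylDist_eq S.contm]
    · exact h _ hε (min_le_left _ _)
    · refine (hη' ?_).le
      rw [Real.dist_eq, add_sub_cancel_left, abs_of_pos hε]
      linarith [min_le_right δ (η/2)]
  · left
    rw [hX]
    show (((c a).2 : ℝ) : Real.Angle) = _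
    have h3 : (c a).2 = (c 0).2 + ((c a).2 - (c 0).2) := by ring
    rw [h3, Real.Angle.coe_add, hP2, zero_add]
    rcases (abs_eq Real.pi_pos.le).1 heq with h4 | h4
    · rw [h4]
    · rw [h4, Real.Angle.coe_neg, Real.Angle.neg_coe_pi]

/-- Lemma 4.5: for any `p̃ ∈ M̃` with `t(p̃) ≤ 0`, the cut locus of `p̃`
contains no point with negative `t`-coordinate; in particular if `t(p̃) = 0` then
`C_p̃ ⊆ {t = 0}`.  Consequently, on the cylinder `M`, the cut locus of the point `p` with
`t(p) = 0`, `θ(p) = 0` satisfies `C_p ⊆ θ⁻¹(π) ∪ t⁻¹(0)`. -/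
theorem stmt11 (m : ℝ → ℝ) (hm : ContDiff ℝ (⊤:ℕ∞) m) (hmpos : ∀ t, 0 < m t)
    (hmeven : ∀ t, m (-t) = m t)
    (hK0 : 0 < gaussK m 0) (hKdec : AntitoneOn (gaussK m) (Ici 0)) :
    (∀ p : ℝ × ℝ, p.1 ≤ 0 → ∀ x ∈ cutLocus m p, ¬ x.1 < 0) ∧
    (∀ p : ℝ × ℝ, p.1 = 0 → cutLocus m p ⊆ {z : ℝ × ℝ | z.1 = 0}) ∧
    cylCutLocus m (0, ((0:ℝ) : Real.Angle)) ⊆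
      {P : ℝ × Real.Angle | P.2 = ((π:ℝ) : Real.Angle)} ∪
      {P : ℝ × Real.Angle | P.1 = 0} := by
  have S := setupOf hm hmpos hmeven hK0 hKdec
  exact ⟨fun p hp x hx => part12 S hp hx, fun p hp x hx => part2 S hp hx,
    fun X hX => part3 S rfl hX⟩
end
end

section
/- Let m : ℝ → ℝ be a smooth positive even function such that the Gaussian curvature K(t) = −m''(t)/m(t) satisfies K(0) > 0 and K is decreasing on [0, ∞). Then the function φ(ν) := 2∫₀^{ξ(ν)} ν/(m(t)√(m(t)² − ν²)) dt is (monotonically) decreasing on the interval (inf m, m(0)). -/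
open Real Set

noncomputable section

theorem aux_int : MeasureTheory.IntegrableOn (fun r : ℝ => 1 / √(r * (1 - r))) (Ioo 0 1) := by
  have h := intervalIntegral.integrableOn_deriv_of_nonneg (a := (0:ℝ)) (b := 1)
    (g := fun r => arcsin (2 * r - 1)) (g' := fun r : ℝ => 1 / √(r * (1 - r)))
    (by fun_prop)
    (by
      intro x hx
      have h1 : HasDerivAt (fun r : ℝ => 2 * r - 1) 2 x := by
        simpa using ((hasDerivAt_id x).const_mul 2).sub_const 1
      have h2 := (hasDerivAt_arcsin (x := 2 * x - 1) (by linarith [hx.1]) (by linarith [hx.2])).comp x h1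
      refine h2.congr_deriv ?_
      have : 1 - (2 * x - 1) ^ 2 = 2 ^ 2 * (x * (1 - x)) := by ring
      rw [this, Real.sqrt_mul (by norm_num), Real.sqrt_sq (by norm_num)]
      have : 0 < √(x * (1 - x)) := Real.sqrt_pos.2 (mul_pos hx.1 (by linarith [hx.2]))
      field_simp)
    (by intro x hx; positivity)
  exact h.mono_set Ioo_subset_Ioc_self

/-- the monotone weight -/
def Qf (m : ℝ → ℝ) (t : ℝ) : ℝ := √(m 0 ^ 2 - m t ^ 2) / (2 * m 0 * (-(deriv m t)))

/-- the substitution -/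
def psi (m : ℝ → ℝ) (ν : ℝ) (t : ℝ) : ℝ :=
  (1 / m t ^ 2 - 1 / m 0 ^ 2) / (1 / ν ^ 2 - 1 / m 0 ^ 2)

section aux
variable {m : ℝ → ℝ}

theorem aux_d1 (hm : ContDiff ℝ (⊤:ℕ∞) m) (t : ℝ) : HasDerivAt m (deriv m t) t :=
  ((hm.differentiable (by simp)) t).hasDerivAt

theorem aux_d2 (hm : ContDiff ℝ (⊤:ℕ∞) m) (t : ℝ) :
    HasDerivAt (deriv m) (deriv (deriv m) t) t := by
  have h : ContDiff ℝ (⊤:ℕ∞) (deriv m) := (contDiff_infty_iff_deriv.1 hm).2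
  exact ((h.differentiable (by simp)) t).hasDerivAt

theorem aux_d0 (hmeven : ∀ t, m (-t) = m t) : deriv m 0 = 0 := by
  have h : deriv (fun t => m (-t)) 0 = deriv m 0 := by
    congr 1; ext t; exact hmeven t
  rw [deriv_comp_neg] at h
  simp at h
  linarith

theorem aux_dd (hmpos : ∀ t, 0 < m t) (t : ℝ) : deriv (deriv m) t = - gaussK m t * m t := by
  have := (hmpos t).ne'
  unfold gaussK
  field_simp

theorem aux_mono (hm : ContDiff ℝ (⊤:ℕ∞) m) (hmpos : ∀ t, 0 < m t)
    (hmeven : ∀ t, m (-t) = m t) (hKdec : AntitoneOn (gaussK m) (Ici 0))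
    {t : ℝ} (ht : 0 < t) (hd : 0 ≤ deriv m t) : MonotoneOn m (Ici t) := by
  have hc : Continuous (deriv m) := continuous_iff_continuousAt.2 fun t => (aux_d2 hm t).continuousAt
  have hc0 : Continuous m := hm.continuous
  have hK : gaussK m t ≤ 0 := by
    by_contra! hK
    have : StrictAntiOn (deriv m) (Icc 0 t) := by
      apply strictAntiOn_of_deriv_neg (convex_Icc 0 t) hc.continuousOn
      intro x hx
      rw [interior_Icc] at hx
      rw [aux_dd hmpos]
      have := hKdec (show x ∈ Ici 0 from hx.1.le) (show t ∈ Ici 0 from ht.le) hx.2.le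
      nlinarith [hmpos x]
    have := this ⟨le_rfl, ht.le⟩ ⟨ht.le, le_rfl⟩ ht
    rw [aux_d0 hmeven] at this
    linarith
  have h1 : MonotoneOn (deriv m) (Ici t) := by
    apply monotoneOn_of_deriv_nonneg (convex_Ici t) hc.continuousOn
      (fun x _ => (aux_d2 hm x).differentiableAt.differentiableWithinAt)
    intro x hx
    rw [interior_Ici] at hx
    have hx : t < x := hx
    rw [aux_dd hmpos]
    have := hKdec (show t ∈ Ici 0 from ht.le) (show x ∈ Ici 0 from (ht.trans hx).le) hx.le
    nlinarith [hmpos x]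
  apply monotoneOn_of_deriv_nonneg (convex_Ici t) hc0.continuousOn
    (fun x _ => (aux_d1 hm x).differentiableAt.differentiableWithinAt)
  intro x hx
  rw [interior_Ici] at hx
  have hx : t < x := hx
  exact hd.trans (h1 self_mem_Ici (show x ∈ Ici t from hx.le) hx.le)

theorem aux_nu (hmpos : ∀ t, 0 < m t) {ν : ℝ} (hν : ν ∈ Ioo (infm m) (m 0)) : 0 < ν :=
  lt_of_le_of_lt (Real.iInf_nonneg fun t => (hmpos t).le) hν.1

theorem aux_xi (hm : ContDiff ℝ (⊤:ℕ∞) m) (hmpos : ∀ t, 0 < m t)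
    (hmeven : ∀ t, m (-t) = m t) (hKdec : AntitoneOn (gaussK m) (Ici 0))
    {ν : ℝ} (hν : ν ∈ Ioo (infm m) (m 0)) :
    0 < xi m ν ∧ m (xi m ν) = ν ∧ ∀ t ∈ Ioc 0 (xi m ν), deriv m t < 0 := by
  have hc0 : Continuous m := hm.continuous
  obtain ⟨b, hb0, hb⟩ : ∃ b, 0 < b ∧ m b < ν := by
    obtain ⟨t, ht⟩ := exists_lt_of_ciInf_lt hν.1
    rcases lt_trichotomy t 0 with h | h | h
    · exact ⟨-t, by linarith, by rw [hmeven]; exact ht⟩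
    · subst h; exact absurd ht (not_lt.2 hν.2.le)
    · exact ⟨t, h, ht⟩
  set S := {t : ℝ | 0 < t ∧ m t = ν} with hS
  have key : ∀ c, 0 < c → m c < ν → ∃ s ∈ S, s < c := by
    intro c hc hmc
    obtain ⟨s, hs, hs'⟩ := intermediate_value_Ioo' hc.le hc0.continuousOn (show ν ∈ Ioo (m c) (m 0) from ⟨hmc, hν.2⟩)
    exact ⟨s, ⟨hs.1, hs'⟩, hs.2⟩
  have hne : S.Nonempty := by
    obtain ⟨s, hs, _⟩ := key b hb0 hb
    exact ⟨s, hs⟩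
  have hbdd : BddBelow S := ⟨0, fun t ht => ht.1.le⟩
  have hcl : IsClosed {t : ℝ | 0 ≤ t ∧ m t = ν} :=
    (isClosed_le continuous_const continuous_id).inter (isClosed_eq hc0 continuous_const)
  have hsub : S ⊆ {t : ℝ | 0 ≤ t ∧ m t = ν} := fun t ht => ⟨ht.1.le, ht.2⟩
  have hmem : xi m ν ∈ {t : ℝ | 0 ≤ t ∧ m t = ν} :=
    closure_minimal hsub hcl (csInf_mem_closure hne hbdd)
  have hpos : 0 < xi m ν := by
    refine lt_of_le_of_ne hmem.1 fun h => ?_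
    have := hmem.2
    rw [← h] at this
    linarith [hν.2]
  refine ⟨hpos, hmem.2, fun t ht => ?_⟩
  by_contra! hd
  have hmono := aux_mono hm hmpos hmeven hKdec ht.1 hd
  have hxb : xi m ν ≤ b := by
    obtain ⟨s, hs, hsb⟩ := key b hb0 hb
    exact (csInf_le hbdd hs).trans hsb.le
  have := hmono (show xi m ν ∈ Ici t from ht.2) (show b ∈ Ici t from ht.2.trans hxb) hxb
  rw [hmem.2] at this
  linarith

theorem aux_anti (hm : ContDiff ℝ (⊤:ℕ∞) m) {x : ℝ} (h : ∀ t ∈ Ioc 0 x, deriv m t < 0) :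
    StrictAntiOn m (Icc 0 x) := by
  apply strictAntiOn_of_deriv_neg (convex_Icc 0 x) hm.continuous.continuousOn
  intro t ht
  rw [interior_Icc] at ht
  exact h t ⟨ht.1, ht.2.le⟩

theorem aux_ineq (hm : ContDiff ℝ (⊤:ℕ∞) m) (hmpos : ∀ t, 0 < m t)
    (hmeven : ∀ t, m (-t) = m t) (hKdec : AntitoneOn (gaussK m) (Ici 0))
    {x : ℝ} (hx : 0 < x) (h : ∀ t ∈ Ioc 0 x, deriv m t < 0) :
    gaussK m x * (m 0 ^ 2 - m x ^ 2) ≤ deriv m x ^ 2 := by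
  have hmono : MonotoneOn (fun t => deriv m t ^ 2 - gaussK m x * (m 0 ^ 2 - m t ^ 2)) (Icc 0 x) := by
    have hD : ∀ t, HasDerivAt (fun t => deriv m t ^ 2 - gaussK m x * (m 0 ^ 2 - m t ^ 2))
        (2 * m t * deriv m t * (gaussK m x - gaussK m t)) t := by
      intro t
      have h1 := ((aux_d2 hm t).pow 2).sub ((((aux_d1 hm t).pow 2).const_sub (m 0 ^ 2)).const_mul (gaussK m x))
      refine h1.congr_deriv ?_
      rw [aux_dd hmpos]
      push_cast
      ring
    apply monotoneOn_of_deriv_nonneg (convex_Icc 0 x)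
      (fun t _ => (hD t).continuousAt.continuousWithinAt)
      (fun t _ => (hD t).differentiableAt.differentiableWithinAt)
    intro t ht
    rw [interior_Icc] at ht
    rw [(hD t).deriv]
    have h1 := hKdec (show t ∈ Ici 0 from ht.1.le) (show x ∈ Ici 0 from hx.le) ht.2.le
    have h2 := h t ⟨ht.1, ht.2.le⟩
    have h3 : 0 ≤ m t * (-(deriv m t)) * (gaussK m t - gaussK m x) :=
      mul_nonneg (mul_nonneg (hmpos t).le (by linarith)) (by linarith)
    nlinarith
  have := hmono ⟨le_rfl, hx.le⟩ ⟨hx.le, le_rfl⟩ hx.le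
  simp only [aux_d0 hmeven] at this
  nlinarith

theorem aux_Q (hm : ContDiff ℝ (⊤:ℕ∞) m) (hmpos : ∀ t, 0 < m t)
    (hmeven : ∀ t, m (-t) = m t) (hKdec : AntitoneOn (gaussK m) (Ici 0))
    {x : ℝ} (h : ∀ t ∈ Ioc 0 x, deriv m t < 0) :
    MonotoneOn (Qf m) (Ioc 0 x) := by
  have hA := aux_anti hm h
  have hlt : ∀ t ∈ Ioc 0 x, m t < m 0 := fun t ht =>
    hA ⟨le_rfl, ht.1.le.trans ht.2⟩ ⟨ht.1.le, ht.2⟩ ht.1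
  have hsq : ∀ t ∈ Ioc 0 x, 0 < m 0 ^ 2 - m t ^ 2 := fun t ht => by
    nlinarith [hlt t ht, hmpos t]
  have hmono : MonotoneOn (fun t => (m 0 ^ 2 - m t ^ 2) / deriv m t ^ 2) (Ioc 0 x) := by
    have hD : ∀ t ∈ Ioc 0 x, HasDerivAt (fun t => (m 0 ^ 2 - m t ^ 2) / deriv m t ^ 2)
        ((2 * m t * (-(deriv m t)) * (deriv m t ^ 2 - gaussK m t * (m 0 ^ 2 - m t ^ 2)))
          / (deriv m t ^ 2) ^ 2) t := by
      intro t ht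
      have h1 := (((aux_d1 hm t).pow 2).const_sub (m 0 ^ 2)).div ((aux_d2 hm t).pow 2)
        (pow_ne_zero 2 (h t ht).ne)
      refine h1.congr_deriv ?_
      rw [aux_dd hmpos]
      push_cast
      congr 1
      simp only [Pi.pow_apply]
      ring
    apply monotoneOn_of_deriv_nonneg (convex_Ioc 0 x)
      (fun t ht => (hD t ht).continuousAt.continuousWithinAt)
      (fun t ht => (hD t (interior_subset ht)).differentiableAt.differentiableWithinAt)
    intro t ht
    have ht := interior_subset ht
    rw [(hD t ht).deriv]
    have h1 := aux_ineq hm hmpos hmeven hKdec ht.1 (fun s hs => h s ⟨hs.1, hs.2.trans ht.2⟩)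
    have h2 := h t ht
    have h3 := hmpos t
    apply div_nonneg _ (by positivity)
    exact mul_nonneg (mul_nonneg (by positivity) (by linarith)) (by linarith)
  have hQ : ∀ t ∈ Ioc 0 x, Qf m t = √((m 0 ^ 2 - m t ^ 2) / deriv m t ^ 2) / (2 * m 0) := by
    intro t ht
    have h2 := h t ht
    have h0 := hmpos 0
    rw [Real.sqrt_div (hsq t ht).le, Real.sqrt_sq_eq_abs, abs_of_neg h2, Qf]
    rw [div_div]
    congr 1
    ring
  intro s hs t ht hst
  rw [hQ s hs, hQ t ht]
  have h0 := hmpos 0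
  exact div_le_div_of_nonneg_right (Real.sqrt_le_sqrt (hmono hs ht hst)) (by positivity)

theorem aux_c (hmpos : ∀ t, 0 < m t) {ν : ℝ} (hν : ν ∈ Ioo (infm m) (m 0)) :
    0 < 1 / ν ^ 2 - 1 / m 0 ^ 2 := by
  have h := aux_nu hmpos hν
  have h0 := hmpos 0
  rw [sub_pos]
  exact one_div_lt_one_div_of_lt (by positivity) (pow_lt_pow_left₀ hν.2 h.le (by norm_num))

theorem aux_psid (hm : ContDiff ℝ (⊤:ℕ∞) m) (hmpos : ∀ t, 0 < m t) (ν t : ℝ) :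
    HasDerivAt (psi m ν) ((2 * (-(deriv m t)) / m t ^ 3) / (1 / ν ^ 2 - 1 / m 0 ^ 2)) t := by
  have h := hmpos t
  have h1 := ((((aux_d1 hm t).pow 2).inv (pow_ne_zero 2 h.ne')).sub_const
    (1 / m 0 ^ 2)).div_const (1 / ν ^ 2 - 1 / m 0 ^ 2)
  have e : psi m ν = fun x => ((m ^ 2)⁻¹ x - 1 / m 0 ^ 2) / (1 / ν ^ 2 - 1 / m 0 ^ 2) := by
    ext s; simp [psi]
  rw [e]
  refine h1.congr_deriv ?_
  congr 1
  simp only [Pi.pow_apply]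
  push_cast
  field_simp

theorem aux_psi (hm : ContDiff ℝ (⊤:ℕ∞) m) (hmpos : ∀ t, 0 < m t)
    (hmeven : ∀ t, m (-t) = m t) (hKdec : AntitoneOn (gaussK m) (Ici 0))
    {ν : ℝ} (hν : ν ∈ Ioo (infm m) (m 0)) :
    StrictMonoOn (psi m ν) (Icc 0 (xi m ν)) ∧ psi m ν '' Ioo 0 (xi m ν) = Ioo 0 1 := by
  obtain ⟨hx, hmx, hd⟩ := aux_xi hm hmpos hmeven hKdec hν
  have hc := aux_c hmpos hν
  have hA := aux_anti hm hd
  have hS : StrictMonoOn (psi m ν) (Icc 0 (xi m ν)) := by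
    intro s hs t ht hst
    have h1 := hA hs ht hst
    have h2 := hmpos t
    unfold psi
    apply div_lt_div_of_pos_right _ hc
    have := one_div_lt_one_div_of_lt (by positivity) (pow_lt_pow_left₀ h1 h2.le (two_ne_zero))
    linarith
  have h0 : psi m ν 0 = 0 := by simp [psi]
  have h1 : psi m ν (xi m ν) = 1 := by
    unfold psi; rw [hmx]; exact div_self hc.ne'
  refine ⟨hS, Subset.antisymm ?_ ?_⟩
  · rintro _ ⟨t, ht, rfl⟩
    rw [← h0, ← h1]
    exact ⟨hS ⟨le_rfl, hx.le⟩ ⟨ht.1.le, ht.2.le⟩ ht.1, hS ⟨ht.1.le, ht.2.le⟩ ⟨hx.le, le_rfl⟩ ht.2⟩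
  · have := intermediate_value_Ioo hx.le
      (fun t _ => (aux_psid hm hmpos ν t).continuousAt.continuousWithinAt : ContinuousOn (psi m ν) _)
    rwa [h0, h1] at this

/-- transformed integrand -/
def gf (m : ℝ → ℝ) (ν r : ℝ) : ℝ :=
  1 / √(r * (1 - r)) * Qf m (Function.invFunOn (psi m ν) (Ioo 0 (xi m ν)) r)

theorem aux_phi (hm : ContDiff ℝ (⊤:ℕ∞) m) (hmpos : ∀ t, 0 < m t)
    (hmeven : ∀ t, m (-t) = m t) (hKdec : AntitoneOn (gaussK m) (Ici 0))
    {ν : ℝ} (hν : ν ∈ Ioo (infm m) (m 0)) :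
    phi m ν = 2 * ∫ r in Ioo (0:ℝ) 1, gf m ν r := by
  obtain ⟨hx, hmx, hd⟩ := aux_xi hm hmpos hmeven hKdec hν
  obtain ⟨hS, him⟩ := aux_psi hm hmpos hmeven hKdec hν
  have hc := aux_c hmpos hν
  have hA := aux_anti hm hd
  have hν0 := aux_nu hmpos hν
  have hinj : InjOn (psi m ν) (Ioo 0 (xi m ν)) := hS.injOn.mono Ioo_subset_Icc_self
  rw [← him, MeasureTheory.integral_image_eq_integral_abs_deriv_smul measurableSet_Ioo
    (fun t _ => (aux_psid hm hmpos ν t).hasDerivWithinAt) hinj, phi,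
    intervalIntegral.integral_of_le hx.le, MeasureTheory.integral_Ioc_eq_integral_Ioo]
  congr 1
  apply MeasureTheory.setIntegral_congr_fun measurableSet_Ioo
  intro t ht
  have htI : t ∈ Icc 0 (xi m ν) := ⟨ht.1.le, ht.2.le⟩
  have hdt := hd t ⟨ht.1, ht.2.le⟩
  have hmt := hmpos t
  have hm0 := hmpos 0
  have hl0 : m t < m 0 := hA ⟨le_rfl, hx.le⟩ htI ht.1
  have hlν : ν < m t := by
    have := hA htI ⟨hx.le, le_rfl⟩ ht.2
    rwa [hmx] at this
  have e1 : Function.invFunOn (psi m ν) (Ioo 0 (xi m ν)) (psi m ν t) = t :=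
    hinj.leftInvOn_invFunOn ht
  have p1 : 0 < m 0 ^ 2 - m t ^ 2 := by nlinarith
  have p2 : 0 < m t ^ 2 - ν ^ 2 := by nlinarith
  set C := 1 / ν ^ 2 - 1 / m 0 ^ 2 with hC
  have e2 : psi m ν t * (1 - psi m ν t) =
      (m 0 ^ 2 - m t ^ 2) * (m t ^ 2 - ν ^ 2) / (m t ^ 2 * ν * m 0 * C) ^ 2 := by
    have a1 : psi m ν t = (m 0 ^ 2 - m t ^ 2) / (m t ^ 2 * m 0 ^ 2 * C) := by
      unfold psi; rw [← hC]; field_simp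
    have a2 : 1 - psi m ν t = (m t ^ 2 - ν ^ 2) / (m t ^ 2 * ν ^ 2 * C) := by
      have : 1 - psi m ν t = (C - (1 / m t ^ 2 - 1 / m 0 ^ 2)) / C := by
        unfold psi; rw [← hC]; field_simp
      rw [this]
      have : C - (1 / m t ^ 2 - 1 / m 0 ^ 2) = (m t ^ 2 - ν ^ 2) / (m t ^ 2 * ν ^ 2) := by
        rw [hC]; field_simp; ring
      rw [this, div_div]
    rw [a2, a1]
    clear_value C
    field_simp
  have e3 : √(psi m ν t * (1 - psi m ν t)) =
      √(m 0 ^ 2 - m t ^ 2) * √(m t ^ 2 - ν ^ 2) / (m t ^ 2 * ν * m 0 * C) := by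
    rw [e2, Real.sqrt_div (by positivity), Real.sqrt_sq (by positivity), Real.sqrt_mul p1.le]
  have hnn : 0 ≤ 2 * (-(deriv m t)) / m t ^ 3 / C := by
    have : 0 < -(deriv m t) := by linarith
    positivity
  simp only [gf, e1, e3, smul_eq_mul, abs_of_nonneg hnn, Qf]
  have q1 : 0 < √(m 0 ^ 2 - m t ^ 2) := Real.sqrt_pos.2 p1
  have q2 : 0 < √(m t ^ 2 - ν ^ 2) := Real.sqrt_pos.2 p2
  have q3 := hdt.ne
  clear_value C
  generalize √(m 0 ^ 2 - m t ^ 2) = A at *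
  generalize √(m t ^ 2 - ν ^ 2) = B at *
  field_simp

theorem aux_inv (hm : ContDiff ℝ (⊤:ℕ∞) m) (hmpos : ∀ t, 0 < m t)
    (hmeven : ∀ t, m (-t) = m t) (hKdec : AntitoneOn (gaussK m) (Ici 0))
    {ν r : ℝ} (hν : ν ∈ Ioo (infm m) (m 0)) (hr : r ∈ Ioo (0:ℝ) 1) :
    Function.invFunOn (psi m ν) (Ioo 0 (xi m ν)) r ∈ Ioo 0 (xi m ν) ∧
    psi m ν (Function.invFunOn (psi m ν) (Ioo 0 (xi m ν)) r) = r := by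
  obtain ⟨hS, him⟩ := aux_psi hm hmpos hmeven hKdec hν
  rw [← him] at hr
  exact ⟨Function.invFunOn_mem hr, Function.invFunOn_eq hr⟩

theorem aux_Q0 (hmpos : ∀ t, 0 < m t) {t : ℝ} (h : deriv m t < 0) : 0 ≤ Qf m t := by
  have h0 := hmpos 0
  exact div_nonneg (Real.sqrt_nonneg _) (mul_nonneg (by positivity) (by linarith))

theorem aux_gint (hm : ContDiff ℝ (⊤:ℕ∞) m) (hmpos : ∀ t, 0 < m t)
    (hmeven : ∀ t, m (-t) = m t) (hKdec : AntitoneOn (gaussK m) (Ici 0))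
    {ν : ℝ} (hν : ν ∈ Ioo (infm m) (m 0)) :
    MeasureTheory.IntegrableOn (gf m ν) (Ioo 0 1) := by
  obtain ⟨hx, hmx, hd⟩ := aux_xi hm hmpos hmeven hKdec hν
  obtain ⟨hS, him⟩ := aux_psi hm hmpos hmeven hKdec hν
  have hQ := aux_Q hm hmpos hmeven hKdec hd
  have hmono : MonotoneOn
      (fun r => Qf m (Function.invFunOn (psi m ν) (Ioo 0 (xi m ν)) r)) (Ioo 0 1) := by
    intro r hr s hs hrs
    obtain ⟨a1, a2⟩ := aux_inv hm hmpos hmeven hKdec hν hr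
    obtain ⟨b1, b2⟩ := aux_inv hm hmpos hmeven hKdec hν hs
    apply hQ (Ioo_subset_Ioc_self a1) (Ioo_subset_Ioc_self b1)
    rw [← hS.le_iff_le (Ioo_subset_Icc_self a1) (Ioo_subset_Icc_self b1), a2, b2]
    exact hrs
  have hmeas := aemeasurable_restrict_of_monotoneOn (μ := MeasureTheory.volume)
    measurableSet_Ioo hmono
  refine MeasureTheory.Integrable.mul_bdd (c := Qf m (xi m ν)) aux_int hmeas.aestronglyMeasurable ?_
  filter_upwards [MeasureTheory.ae_restrict_mem measurableSet_Ioo] with r hr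
  obtain ⟨a1, a2⟩ := aux_inv hm hmpos hmeven hKdec hν hr
  rw [Real.norm_of_nonneg (aux_Q0 hmpos (hd _ (Ioo_subset_Ioc_self a1)))]
  exact hQ (Ioo_subset_Ioc_self a1) ⟨hx, le_rfl⟩ a1.2.le

end aux

/-- Proposition 4.6: if `m` is a smooth positive even function whose
Gaussian curvature `K(t) = -m''(t)/m(t)` satisfies `K 0 > 0` and `K` is decreasing on
`[0,∞)`, then `φ` is decreasing on `(inf m, m 0)`. -/
theorem stmt12 (m : ℝ → ℝ) (hm : ContDiff ℝ (⊤:ℕ∞) m) (hmpos : ∀ t, 0 < m t)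
    (hmeven : ∀ t, m (-t) = m t)
    (hK0 : 0 < gaussK m 0) (hKdec : AntitoneOn (gaussK m) (Ici 0)) :
    AntitoneOn (phi m) (Ioo (infm m) (m 0)) := by
  intro ν₁ h₁ ν₂ h₂ h12
  rw [aux_phi hm hmpos hmeven hKdec h₁, aux_phi hm hmpos hmeven hKdec h₂]
  apply mul_le_mul_of_nonneg_left _ (by norm_num)
  obtain ⟨hx1, hmx1, hd1⟩ := aux_xi hm hmpos hmeven hKdec h₁
  obtain ⟨hx2, hmx2, hd2⟩ := aux_xi hm hmpos hmeven hKdec h₂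
  apply MeasureTheory.integral_mono_of_nonneg _ (aux_gint hm hmpos hmeven hKdec h₁)
  · filter_upwards [MeasureTheory.ae_restrict_mem measurableSet_Ioo] with r hr
    obtain ⟨a1, a2⟩ := aux_inv hm hmpos hmeven hKdec h₁ hr
    obtain ⟨b1, b2⟩ := aux_inv hm hmpos hmeven hKdec h₂ hr
    unfold gf
    apply mul_le_mul_of_nonneg_left _ (by positivity)
    set t := Function.invFunOn (psi m ν₁) (Ioo 0 (xi m ν₁)) r
    set s := Function.invFunOn (psi m ν₂) (Ioo 0 (xi m ν₂)) r
    have hst : s ≤ t := by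
      by_contra! hlt
      have hA := aux_anti hm hd2 ⟨a1.1.le, (hlt.trans b1.2).le⟩ (Ioo_subset_Icc_self b1) hlt
      have c1 := aux_c hmpos h₁
      have c2 := aux_c hmpos h₂
      unfold psi at a2 b2
      rw [div_eq_iff c1.ne'] at a2
      rw [div_eq_iff c2.ne'] at b2
      have p1 := aux_nu hmpos h₁
      have hcc := one_div_le_one_div_of_le (by positivity) (pow_le_pow_left₀ p1.le h12 2)
      have q := hmpos s
      have hmm := one_div_lt_one_div_of_lt (by positivity) (pow_lt_pow_left₀ hA q.le two_ne_zero)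
      nlinarith [hr.1]
    exact aux_Q hm hmpos hmeven hKdec hd1 ⟨b1.1, hst.trans a1.2.le⟩ (Ioo_subset_Ioc_self a1) hst
  · filter_upwards [MeasureTheory.ae_restrict_mem measurableSet_Ioo] with r hr
    obtain ⟨b1, b2⟩ := aux_inv hm hmpos hmeven hKdec h₂ hr
    exact mul_nonneg (by positivity) (aux_Q0 hmpos (hd2 _ (Ioo_subset_Ioc_self b1)))
end
end
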